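/- Consider the sparse linear regression model with all quantities k=k_n, p=p_n, τ=τ_n, σ=σ_n depending on n and asymptotics as n→∞, and set μ = τ/σ. Assume k/p → 0 and (k·log p)/n → 0. If μ/√(log(p/k)) → ∞ (the high-SNR Regime III), then the minimax risk over the SNR-aware parameter space satisfies R(Θ(k,τ), σ) / (2σ²·k·log(p/k)) → 1. -/

import Mathlib

open MeasureTheory ProbabilityTheory Filter
open scoped NNReal ENNReal

noncomputable section

/-- Joint law of the data: a design matrix with i.i.d. `N(0, (1/n) I_p)` rows
(entries i.i.d. `N(0, 1/n)`) and an independent noise vector with i.i.d. `N(0,1)` entries. -/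
def model (n p : ℕ) : Measure ((Fin n → Fin p → ℝ) × (Fin n → ℝ)) :=
  (Measure.pi fun _ : Fin n => Measure.pi fun _ : Fin p => gaussianReal 0 (n : ℝ≥0)⁻¹).prod
    (Measure.pi fun _ : Fin n => gaussianReal 0 1)

/-- Expected squared-error risk `E_β ‖est(X, Xβ + σ z) − β‖₂²` of an estimator `est`
under the true parameter `β` and noise level `σ`. -/
def risk (n p : ℕ) (σ : ℝ)
    (est : (Fin n → Fin p → ℝ) × (Fin n → ℝ) → Fin p → ℝ) (β : Fin p → ℝ) : ℝ≥0∞ :=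
  ∫⁻ ω, ENNReal.ofReal
      (∑ j, (est (ω.1, fun i => (∑ l, ω.1 i l * β l) + σ * ω.2 i) j - β j) ^ 2) ∂ model n p

/-- The `ℓ₀` norm: number of nonzero coordinates. -/
def l0norm {p : ℕ} (β : Fin p → ℝ) : ℕ := (Finset.univ.filter fun j => β j ≠ 0).card

/-- The SNR-aware sparse parameter space `Θ(k, τ)`. -/
def Theta (p k : ℕ) (τ : ℝ) : Set (Fin p → ℝ) :=
  {β | l0norm β ≤ k ∧ ∑ j, β j ^ 2 ≤ k * τ ^ 2}

/-- The minimax risk `R(Θ(k,τ), σ)`: infimum over measurable estimators of the supremum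
risk over `Θ(k,τ)`. -/
def minimaxRisk (n p k : ℕ) (τ σ : ℝ) : ℝ≥0∞ :=
  ⨅ (est : (Fin n → Fin p → ℝ) × (Fin n → ℝ) → Fin p → ℝ) (_ : Measurable est),
    ⨆ β ∈ Theta p k τ, risk n p σ est β

/-! ### Gaussian integrals over product spaces -/

lemma lintegral_pi_prod {ι : Type*} [Fintype ι] {E : ι → Type*} [∀ i, MeasurableSpace (E i)]
    (μ : ∀ i, Measure (E i)) [∀ i, IsProbabilityMeasure (μ i)] (f : ∀ i, E i → ℝ≥0∞)
    (hf : ∀ i, Measurable (f i)) :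
    ∫⁻ x, ∏ i, f i (x i) ∂(Measure.pi μ) = ∏ i, ∫⁻ x, f i x ∂(μ i) := by
  rw [lintegral_prod_eq_prod_lintegral_of_indepFun Finset.univ (fun i (x : ∀ i, E i) => f i (x i))
    (iIndepFun_pi fun i => (hf i).aemeasurable)
    (fun i => (hf i).comp (measurable_pi_apply i))]
  refine Finset.prod_congr rfl fun i _ => ?_
  exact (measurePreserving_eval μ i).lintegral_comp (hf i)

lemma map_linear_pi_gaussianReal {ι : Type*} [Fintype ι] (v : ι → ℝ≥0) (c : ι → ℝ) :
    (Measure.pi fun i => gaussianReal 0 (v i)).map (fun x => ∑ i, c i * x i) =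
      gaussianReal 0 (Real.toNNReal (∑ i, c i ^ 2 * v i)) := by
  have hm : Measurable fun x : ι → ℝ => ∑ i, c i * x i := by fun_prop
  have := Measure.isProbabilityMeasure_map (μ := Measure.pi fun i => gaussianReal 0 (v i))
    hm.aemeasurable
  refine Measure.ext_of_charFun ?_
  ext t
  rw [charFun_gaussianReal, charFun_apply_real, integral_map hm.aemeasurable (by fun_prop)]
  have h1 : ∀ x : ι → ℝ, Complex.exp (t * ((∑ i, c i * x i : ℝ) : ℂ) * Complex.I) =
      ∏ i, Complex.exp (((t * c i : ℝ) : ℂ) * (x i) * Complex.I) := by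
    intro x
    rw [← Complex.exp_sum]
    congr 1
    push_cast
    rw [Finset.mul_sum, Finset.sum_mul]
    exact Finset.sum_congr rfl fun i _ => by ring
  simp_rw [h1]
  rw [integral_fintype_prod_eq_prod
    (f := fun i (x : ℝ) => Complex.exp (((t * c i : ℝ) : ℂ) * x * Complex.I))]
  simp_rw [← charFun_apply_real, charFun_gaussianReal]
  rw [← Complex.exp_sum, Real.coe_toNNReal _ (by positivity)]
  congr 1
  push_cast
  simp only [mul_zero, zero_mul, zero_sub, Finset.sum_neg_distrib]
  rw [Finset.sum_mul, Finset.sum_div]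
  congr 1
  exact Finset.sum_congr rfl fun i _ => by ring

lemma lintegral_exp_sq_gaussianReal (v : ℝ≥0) (t : ℝ) (h : 2 * t * v < 1) :
    ∫⁻ x, ENNReal.ofReal (Real.exp (t * x ^ 2)) ∂(gaussianReal 0 v) =
      ENNReal.ofReal (Real.sqrt (1 - 2 * t * v))⁻¹ := by
  rcases eq_or_ne v 0 with rfl | hv
  · simp [gaussianReal_zero_var]
  have hv' : (0 : ℝ) < v := by positivity
  set d : ℝ := 1 - 2 * t * v with hd
  have hdpos : 0 < d := by linarith
  set w : ℝ≥0 := Real.toNNReal (v / d) with hw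
  have hwr : (w : ℝ) = v / d := Real.coe_toNNReal _ (by positivity)
  have hw0 : w ≠ 0 := by
    intro h0
    rw [h0] at hwr
    have : (0 : ℝ) < v / d := by positivity
    rw [← hwr] at this
    simp at this
  rw [gaussianReal_of_var_ne_zero _ hv, lintegral_withDensity_eq_lintegral_mul _
    (measurable_gaussianPDF _ _) (by fun_prop)]
  have key : ∀ x : ℝ, (gaussianPDF 0 v * fun x => ENNReal.ofReal (Real.exp (t * x ^ 2))) x =
      ENNReal.ofReal (Real.sqrt d)⁻¹ * ENNReal.ofReal (gaussianPDFReal 0 w x) := by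
    intro x
    rw [Pi.mul_apply, gaussianPDF, ← ENNReal.ofReal_mul (gaussianPDFReal_nonneg _ _ _),
      ← ENNReal.ofReal_mul (by positivity)]
    congr 1
    rw [gaussianPDFReal, gaussianPDFReal, hwr, mul_assoc, ← Real.exp_add, ← mul_assoc]
    have hs : Real.sqrt (2 * Real.pi * (v / d)) = Real.sqrt (2 * Real.pi * v) / Real.sqrt d := by
      rw [← Real.sqrt_div (by positivity)]
      congr 1
      ring
    rw [hs]
    have hsd : Real.sqrt d ≠ 0 := by positivity
    congr 1
    · field_simp
    · congr 1
      rw [hd]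
      field_simp
      ring
  simp_rw [key]
  rw [lintegral_const_mul _ (by fun_prop), lintegral_gaussianPDFReal_eq_one 0 hw0, mul_one]

lemma lintegral_exp_sum_sq_pi {ι : Type*} [Fintype ι] (v : ℝ≥0) (t : ℝ) (h : 2 * t * v < 1) :
    ∫⁻ x, ENNReal.ofReal (Real.exp (t * ∑ i, x i ^ 2))
        ∂(Measure.pi fun _ : ι => gaussianReal 0 v) =
      ENNReal.ofReal ((Real.sqrt (1 - 2 * t * v))⁻¹ ^ Fintype.card ι) := by
  have : ∀ x : ι → ℝ, ENNReal.ofReal (Real.exp (t * ∑ i, x i ^ 2)) =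
      ∏ i, ENNReal.ofReal (Real.exp (t * x i ^ 2)) := by
    intro x
    rw [Finset.mul_sum, Real.exp_sum, ENNReal.ofReal_prod_of_nonneg (fun i _ => by positivity)]
  simp_rw [this]
  rw [lintegral_pi_prod (fun _ => gaussianReal 0 v)
    (fun _ x => ENNReal.ofReal (Real.exp (t * x ^ 2))) (fun _ => by fun_prop),
    Finset.prod_const, lintegral_exp_sq_gaussianReal v t h, ENNReal.ofReal_pow (by positivity)]
  simp

lemma gaussianReal_eq_withDensity_exp (h : ℝ) :
    gaussianReal h 1 =
      (gaussianReal 0 1).withDensity fun z => ENNReal.ofReal (Real.exp (h * z - h ^ 2 / 2)) := by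
  rw [gaussianReal_of_var_ne_zero _ one_ne_zero, gaussianReal_of_var_ne_zero _ one_ne_zero,
    ← withDensity_mul _ (measurable_gaussianPDF _ _) (by fun_prop)]
  congr 1
  ext x
  rw [Pi.mul_apply, gaussianPDF, gaussianPDF, ← ENNReal.ofReal_mul (gaussianPDFReal_nonneg _ _ _)]
  congr 1
  rw [gaussianPDFReal, gaussianPDFReal, mul_assoc _ (Real.exp _) (Real.exp _), ← Real.exp_add]
  congr 2
  simp
  ring

/-- The Cameron-Martin formula for the standard Gaussian measure on `ℝ^ι`. -/
lemma lintegral_gaussian_shift {ι : Type*} [Fintype ι] (h : ι → ℝ) (f : (ι → ℝ) → ℝ≥0∞)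
    (hf : Measurable f) :
    ∫⁻ z, f (fun i => z i + h i) ∂(Measure.pi fun _ : ι => gaussianReal 0 1) =
      ∫⁻ z, ENNReal.ofReal (Real.exp (∑ i, (h i * z i - h i ^ 2 / 2))) * f z
        ∂(Measure.pi fun _ : ι => gaussianReal 0 1) := by
  have hmap : (Measure.pi fun _ : ι => gaussianReal 0 1).map (fun z i => z i + h i) =
      Measure.pi fun i => gaussianReal (h i) 1 := by
    rw [Measure.pi_map_pi (f := fun i (z : ℝ) => z + h i) (fun i => by fun_prop)]
    simp_rw [gaussianReal_map_add_const, zero_add]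
  have hmeas : Measurable fun z : ι → ℝ =>
      ENNReal.ofReal (Real.exp (∑ i, (h i * z i - h i ^ 2 / 2))) := by fun_prop
  have hdens : Measure.pi (fun i => gaussianReal (h i) 1) =
      (Measure.pi fun _ : ι => gaussianReal 0 1).withDensity
        fun z => ENNReal.ofReal (Real.exp (∑ i, (h i * z i - h i ^ 2 / 2))) := by
    refine Measure.pi_eq fun s hs => ?_
    rw [withDensity_apply _ (MeasurableSet.univ_pi hs), ← lintegral_indicator
      (MeasurableSet.univ_pi hs)]
    have : ∀ z : ι → ℝ, (Set.univ.pi s).indicator (fun z : ι → ℝ =>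
        ENNReal.ofReal (Real.exp (∑ i, (h i * z i - h i ^ 2 / 2)))) z =
        ∏ i, (s i).indicator (fun x => ENNReal.ofReal (Real.exp (h i * x - h i ^ 2 / 2))) (z i) := by
      intro z
      by_cases hz : z ∈ Set.univ.pi s
      · rw [Set.indicator_of_mem hz, Real.exp_sum,
          ENNReal.ofReal_prod_of_nonneg (fun i _ => by positivity)]
        exact Finset.prod_congr rfl fun i _ => by
          rw [Set.indicator_of_mem (hz i (Set.mem_univ i))]
      · rw [Set.indicator_of_notMem hz]
        simp only [Set.mem_univ_pi, not_forall] at hz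
        obtain ⟨i, hi⟩ := hz
        exact (Finset.prod_eq_zero (Finset.mem_univ i) (Set.indicator_of_notMem hi _)).symm
    simp_rw [this]
    rw [lintegral_pi_prod (fun _ => gaussianReal 0 1)
      (fun i => (s i).indicator fun x => ENNReal.ofReal (Real.exp (h i * x - h i ^ 2 / 2)))
      (fun i => Measurable.indicator (by fun_prop) (hs i))]
    refine Finset.prod_congr rfl fun i _ => ?_
    rw [lintegral_indicator (hs i), gaussianReal_eq_withDensity_exp (h i),
      withDensity_apply _ (hs i)]
  rw [← lintegral_map hf (by fun_prop : Measurable fun (z : ι → ℝ) i => z i + h i), hmap, hdens,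
    lintegral_withDensity_eq_lintegral_mul _ hmeas hf]
  rfl

lemma lintegral_exp_linear_pi {ι : Type*} [Fintype ι] (c : ι → ℝ) :
    ∫⁻ z, ENNReal.ofReal (Real.exp (∑ i, c i * z i)) ∂(Measure.pi fun _ : ι => gaussianReal 0 1) =
      ENNReal.ofReal (Real.exp (∑ i, c i ^ 2 / 2)) := by
  have h := lintegral_gaussian_shift c (fun _ => 1) measurable_const
  simp only [lintegral_const, measure_univ, mul_one] at h
  have : ∀ z : ι → ℝ, ENNReal.ofReal (Real.exp (∑ i, c i * z i)) =
      ENNReal.ofReal (Real.exp (∑ i, c i ^ 2 / 2)) *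
        ENNReal.ofReal (Real.exp (∑ i, (c i * z i - c i ^ 2 / 2))) := by
    intro z
    rw [← ENNReal.ofReal_mul (by positivity), ← Real.exp_add, Finset.sum_sub_distrib]
    congr 2
    ring
  simp_rw [this]
  rw [lintegral_const_mul _ (by fun_prop), ← h, mul_one]

/-- Inverse moment of a scaled chi-squared variable. -/
lemma lintegral_inv_sum_sq_pi_le {ι : Type*} [Fintype ι] (v : ℝ≥0) (hv : 0 < v)
    (hm : 2 < Fintype.card ι) :
    ∫⁻ x, ENNReal.ofReal (1 / ∑ i, x i ^ 2) ∂(Measure.pi fun _ : ι => gaussianReal 0 v) ≤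
      ENNReal.ofReal (1 / (v * (Fintype.card ι - 2))) := by
  set m := Fintype.card ι
  have hm' : (2 : ℝ) < m := by exact_mod_cast hm
  have hv' : (0 : ℝ) < v := by positivity
  have hderiv : ∀ N : ℝ, 0 < N → ENNReal.ofReal (1 / N) ≤
      ∫⁻ t in Set.Ioi (0 : ℝ), ENNReal.ofReal (Real.exp (-t * N)) := by
    intro N hN
    have hd : ∀ x ∈ Set.Ioi (0 : ℝ), HasDerivAt (fun t => -(1 / N) * Real.exp (-t * N))
        (Real.exp (-x * N)) x := by
      intro x _
      have := (((hasDerivAt_id x).neg.mul_const N).exp).const_mul (-(1 / N))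
      refine this.congr_deriv ?_
      simp
      field_simp
    have hlim : Tendsto (fun t => -(1 / N) * Real.exp (-t * N)) atTop (nhds 0) := by
      have : Tendsto (fun t : ℝ => -t * N) atTop atBot := by
        simp_rw [neg_mul]
        exact tendsto_neg_atTop_atBot.comp (tendsto_id.atTop_mul_const hN)
      simpa using (Real.tendsto_exp_atBot.comp this).const_mul (-(1 / N))
    have hc : ContinuousWithinAt (fun t => -(1 / N) * Real.exp (-t * N)) (Set.Ici 0) 0 := by
      fun_prop
    rw [← ofReal_integral_eq_lintegral_ofReal
      (integrableOn_Ioi_deriv_of_nonneg hc hd (fun x _ => by positivity) hlim)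
      (Eventually.of_forall fun x => by positivity),
      integral_Ioi_of_hasDerivAt_of_nonneg hc hd (fun x _ => by positivity) hlim]
    simp
  have hle : ∀ x : ι → ℝ, ENNReal.ofReal (1 / ∑ i, x i ^ 2) ≤
      ∫⁻ t in Set.Ioi (0 : ℝ), ENNReal.ofReal (Real.exp (-t * ∑ i, x i ^ 2)) := by
    intro x
    rcases (Finset.sum_nonneg fun i (_ : i ∈ Finset.univ) => sq_nonneg (x i)).eq_or_lt with h | h
    · rw [← h]; simp
    · exact hderiv _ h
  refine (lintegral_mono hle).trans ?_
  rw [lintegral_lintegral_swap (by fun_prop)]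
  have hin : ∀ t ∈ Set.Ioi (0 : ℝ), ∫⁻ x, ENNReal.ofReal (Real.exp (-t * ∑ i, x i ^ 2))
      ∂(Measure.pi fun _ : ι => gaussianReal 0 v) =
      ENNReal.ofReal ((1 + 2 * t * v) ^ (-(m : ℝ) / 2)) := by
    intro t ht
    have ht' : 0 < t := ht
    have h0 : (0 : ℝ) < t * v := by positivity
    rw [lintegral_exp_sum_sq_pi v (-t) (by nlinarith)]
    congr 1
    rw [show 1 - 2 * -t * (v : ℝ) = 1 + 2 * t * v by ring, Real.sqrt_eq_rpow,
      ← Real.rpow_neg (by positivity), ← Real.rpow_natCast, ← Real.rpow_mul (by positivity)]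
    congr 1
    simp only [m]
    ring
  rw [setLIntegral_congr_fun measurableSet_Ioi hin]
  set e : ℝ := -(m : ℝ) / 2 + 1 with he
  have he0 : e < 0 := by linarith
  have hd : ∀ x ∈ Set.Ioi (0 : ℝ), HasDerivAt (fun t : ℝ => (1 / (2 * v * e)) *
      (1 + 2 * t * v) ^ e) ((1 + 2 * x * v) ^ (-(m : ℝ) / 2)) x := by
    intro x hx
    have hx' : 0 < x := hx
    have h1 : HasDerivAt (fun t : ℝ => 1 + 2 * t * (v : ℝ)) (2 * v) x := by
      have := (((hasDerivAt_id x).const_mul (2 : ℝ)).mul_const (v : ℝ)).const_add (1 : ℝ)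
      exact this.congr_deriv (by simp)
    have h2 := (h1.rpow_const (p := e) (Or.inl (by positivity))).const_mul (1 / (2 * v * e))
    refine h2.congr_deriv ?_
    rw [show e - 1 = -(m : ℝ) / 2 by rw [he]; ring]
    have := he0.ne
    field_simp
  have hlim : Tendsto (fun t : ℝ => (1 / (2 * v * e)) * (1 + 2 * t * v) ^ e) atTop (nhds 0) := by
    have h1 : Tendsto (fun t : ℝ => 1 + 2 * t * (v : ℝ)) atTop atTop :=
      tendsto_atTop_add_const_left _ _
        ((tendsto_id.const_mul_atTop (by norm_num : (0 : ℝ) < 2)).atTop_mul_const hv')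
    have h2 := (tendsto_rpow_neg_atTop (y := -e) (by linarith)).comp h1
    simpa using h2.const_mul (1 / (2 * v * e))
  have hc : ContinuousWithinAt (fun t : ℝ => (1 / (2 * v * e)) * (1 + 2 * t * v) ^ e)
      (Set.Ici 0) 0 := by
    refine ContinuousAt.continuousWithinAt (continuousAt_const.mul ?_)
    exact ContinuousAt.rpow_const (by fun_prop) (Or.inl (by norm_num))
  have hnn : ∀ x ∈ Set.Ioi (0 : ℝ), (0 : ℝ) ≤ (1 + 2 * x * v) ^ (-(m : ℝ) / 2) := by
    intro x hx
    have hx' : 0 < x := hx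
    positivity
  rw [← ofReal_integral_eq_lintegral_ofReal (integrableOn_Ioi_deriv_of_nonneg hc hd hnn hlim)
    ((ae_restrict_iff' measurableSet_Ioi).2 (Eventually.of_forall hnn)),
    integral_Ioi_of_hasDerivAt_of_nonneg hc hd hnn hlim]
  apply le_of_eq
  congr 1
  have h1 : (m : ℝ) - 2 ≠ 0 := by linarith
  have h2 : e = -((m : ℝ) - 2) / 2 := by rw [he]; ring
  rw [h2, mul_zero, zero_mul, add_zero, Real.one_rpow]
  field_simp
  ring

/-! ### Lower bound: block-sparse prior -/

lemma sum_weighted_loss_ge {ι : Type*} [Fintype ι] [DecidableEq ι] (L T x : ι → ℝ) (a M : ℝ)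
    (hM : 0 ≤ M) (hL : ∀ J, 0 ≤ L J) (hT : ∀ J, L J ≤ min (L J) M + T J) :
    a ^ 2 * ∑ J, L J ≤ (∑ J, L J * ∑ j, (x j - if j = J then a else 0) ^ 2) + a ^ 2 * M +
      a ^ 2 * ∑ J, T J := by
  set l : ι → ℝ := fun J => min (L J) M with hl
  have hl0 : ∀ J, 0 ≤ l J := fun J => le_min (hL J) hM
  have hlM : ∀ J, l J ≤ M := fun J => min_le_right _ _
  set S := ∑ J, l J with hS
  have hS0 : 0 ≤ S := Finset.sum_nonneg fun J _ => hl0 J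
  set A := ∑ j, x j ^ 2 with hA
  have hloss : ∀ J, ∑ j, (x j - if j = J then a else 0) ^ 2 = A - 2 * a * x J + a ^ 2 := by
    intro J
    have : ∀ j, (x j - if j = J then a else 0) ^ 2 =
        x j ^ 2 + (if j = J then a ^ 2 - 2 * a * x j else 0) := by
      intro j
      split_ifs <;> ring
    simp_rw [this]
    rw [Finset.sum_add_distrib, Finset.sum_ite_eq' Finset.univ J]
    simp
    ring
  have h1 : ∑ J, l J * (A - 2 * a * x J + a ^ 2) ≤
      ∑ J, L J * ∑ j, (x j - if j = J then a else 0) ^ 2 := by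
    refine Finset.sum_le_sum fun J _ => ?_
    rw [← hloss J]
    exact mul_le_mul_of_nonneg_right (min_le_left _ _) (Finset.sum_nonneg fun j _ => sq_nonneg _)
  have h2 : ∑ J, l J * (A - 2 * a * x J + a ^ 2) = S * A - 2 * a * (∑ J, l J * x J) + a ^ 2 * S := by
    rw [hS, Finset.sum_mul, Finset.mul_sum, Finset.mul_sum, ← Finset.sum_sub_distrib,
      ← Finset.sum_add_distrib]
    exact Finset.sum_congr rfl fun J _ => by ring
  have h3 : ∑ J, L J ≤ S + ∑ J, T J := by
    rw [hS, ← Finset.sum_add_distrib]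
    exact Finset.sum_le_sum fun J _ => hT J
  have h4 : 0 ≤ S * A - 2 * a * (∑ J, l J * x J) + a ^ 2 * M := by
    rcases hS0.eq_or_lt with h0 | hpos
    · have : ∀ J, l J = 0 := fun J =>
        (Finset.sum_eq_zero_iff_of_nonneg (fun J _ => hl0 J)).1 h0.symm J (Finset.mem_univ J)
      simp only [this, ← h0]
      simp
      positivity
    · have h5 : 0 ≤ ∑ J, (S * x J - a * l J) ^ 2 := Finset.sum_nonneg fun J _ => sq_nonneg _
      have h6 : ∑ J, (S * x J - a * l J) ^ 2 =
          S ^ 2 * A - 2 * a * S * (∑ J, l J * x J) + a ^ 2 * ∑ J, l J ^ 2 := by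
        clear_value S
        rw [hA, Finset.mul_sum, Finset.mul_sum, Finset.mul_sum, ← Finset.sum_sub_distrib,
          ← Finset.sum_add_distrib]
        exact Finset.sum_congr rfl fun J _ => by ring
      have h7 : ∑ J, l J ^ 2 ≤ M * S := by
        rw [hS, Finset.mul_sum]
        exact Finset.sum_le_sum fun J _ => by nlinarith [hl0 J, hlM J]
      have h8 : 0 ≤ S * (S * A - 2 * a * (∑ J, l J * x J) + a ^ 2 * M) := by
        nlinarith [mul_le_mul_of_nonneg_left h7 (sq_nonneg a)]
      exact nonneg_of_mul_nonneg_right h8 hpos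
  nlinarith [mul_le_mul_of_nonneg_left h3 (sq_nonneg a)]

lemma exp_le_min_add (u γ s : ℝ) (hs : 0 ≤ s) :
    Real.exp u ≤ min (Real.exp u) (Real.exp γ) + Real.exp ((1 + s) * u - s * γ) := by
  rcases le_total u γ with h | h
  · rw [min_eq_left (Real.exp_le_exp.2 h)]
    linarith [Real.exp_pos ((1 + s) * u - s * γ)]
  · have : Real.exp u ≤ Real.exp ((1 + s) * u - s * γ) :=
      Real.exp_le_exp.2 (by nlinarith)
    have h0 : 0 ≤ min (Real.exp u) (Real.exp γ) := le_min (Real.exp_pos _).le (Real.exp_pos _).le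
    linarith

lemma bayes_lower_fixed_design {ι : Type*} [Fintype ι] {n : ℕ} [DecidableEq ι]
    (h : ι → Fin n → ℝ) (x : (Fin n → ℝ) → ι → ℝ) (hx : Measurable x) (a s γ : ℝ) (hs : 0 ≤ s) :
    ENNReal.ofReal (a ^ 2) * Fintype.card ι ≤
      (∑ J, ∫⁻ z, ENNReal.ofReal (∑ j, (x (fun i => z i + h J i) j - if j = J then a else 0) ^ 2)
        ∂(Measure.pi fun _ : Fin n => gaussianReal 0 1)) +
      ENNReal.ofReal (a ^ 2 * Real.exp γ) +
      ∑ J, ENNReal.ofReal (a ^ 2 * Real.exp (-(s * γ))) *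
        ENNReal.ofReal (Real.exp ((s ^ 2 + s) / 2 * ∑ i, h J i ^ 2)) := by
  set P := Measure.pi fun _ : Fin n => gaussianReal 0 1
  set u : ι → (Fin n → ℝ) → ℝ := fun J z => ∑ i, (h J i * z i - h J i ^ 2 / 2) with hu
  have hum : ∀ J, Measurable (u J) := fun J => by fun_prop
  have hxj : ∀ j, Measurable fun z => x z j := fun j => (measurable_pi_apply j).comp hx
  set ℓ : ι → (Fin n → ℝ) → ℝ := fun J z => ∑ j, (x z j - if j = J then a else 0) ^ 2 with hℓ
  have hℓm : ∀ J, Measurable (ℓ J) := fun J => by fun_prop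
  have hℓ0 : ∀ J z, 0 ≤ ℓ J z := fun J z => Finset.sum_nonneg fun j _ => sq_nonneg _
  have hL1 : ∀ J, ∫⁻ z, ENNReal.ofReal (Real.exp (u J z)) ∂P = 1 := by
    intro J
    have := lintegral_gaussian_shift (h J) (fun _ => 1) measurable_const
    simp only [lintegral_const, measure_univ, mul_one] at this
    exact this.symm
  have hpt : ∀ z, ∑ J, ENNReal.ofReal (a ^ 2) * ENNReal.ofReal (Real.exp (u J z)) ≤
      (∑ J, ENNReal.ofReal (Real.exp (u J z)) * ENNReal.ofReal (ℓ J z)) +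
      ENNReal.ofReal (a ^ 2 * Real.exp γ) +
      ∑ J, ENNReal.ofReal (a ^ 2) * ENNReal.ofReal (Real.exp ((1 + s) * u J z - s * γ)) := by
    intro z
    have := sum_weighted_loss_ge (fun J => Real.exp (u J z))
      (fun J => Real.exp ((1 + s) * u J z - s * γ)) (x z) a (Real.exp γ) (Real.exp_pos _).le
      (fun J => (Real.exp_pos _).le) (fun J => exp_le_min_add _ _ _ hs)
    have h2 := ENNReal.ofReal_le_ofReal this
    rw [ENNReal.ofReal_add, ENNReal.ofReal_add, Finset.mul_sum, Finset.mul_sum,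
      ENNReal.ofReal_sum_of_nonneg, ENNReal.ofReal_sum_of_nonneg, ENNReal.ofReal_sum_of_nonneg] at h2
    · refine le_of_eq_of_le ?_ (h2.trans (le_of_eq ?_))
      · exact Finset.sum_congr rfl fun J _ => (ENNReal.ofReal_mul (sq_nonneg a)).symm
      · congr 1
        · congr 1
          exact Finset.sum_congr rfl fun J _ => ENNReal.ofReal_mul (Real.exp_pos _).le
        · exact Finset.sum_congr rfl fun J _ => ENNReal.ofReal_mul (sq_nonneg a)
    all_goals try intro _ _
    all_goals positivity
  have hlint := lintegral_mono (μ := P) hpt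
  rw [lintegral_finsetSum _ (fun J _ => by fun_prop), lintegral_add_left (by fun_prop),
    lintegral_add_left (by fun_prop), lintegral_finsetSum _ (fun J _ => by fun_prop),
    lintegral_finsetSum _ (fun J _ => by fun_prop)] at hlint
  refine le_of_eq_of_le ?_ (hlint.trans (le_of_eq ?_))
  · simp_rw [lintegral_const_mul (ENNReal.ofReal (a ^ 2))
      ((hum _).exp.ennreal_ofReal), hL1]
    simp [mul_comm]
  · congr 1
    · congr 1
      · refine Finset.sum_congr rfl fun J _ => ?_
        exact (lintegral_gaussian_shift (h J) (fun z => ENNReal.ofReal (ℓ J z))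
          (hℓm J).ennreal_ofReal).symm
      · simp [P]
    · refine Finset.sum_congr rfl fun J _ => ?_
      have : ∀ z, ENNReal.ofReal (a ^ 2) * ENNReal.ofReal (Real.exp ((1 + s) * u J z - s * γ)) =
          ENNReal.ofReal (a ^ 2 * Real.exp (-(s * γ)) *
            Real.exp (-((1 + s) * ∑ i, h J i ^ 2 / 2))) *
            ENNReal.ofReal (Real.exp (∑ i, ((1 + s) * h J i) * z i)) := by
        intro z
        rw [← ENNReal.ofReal_mul (sq_nonneg a), ← ENNReal.ofReal_mul (by positivity), mul_assoc,
          mul_assoc, ← Real.exp_add, ← Real.exp_add]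
        congr 3
        simp only [hu, Finset.sum_sub_distrib, mul_sub, mul_assoc, ← Finset.mul_sum]
        ring
      simp_rw [this]
      rw [lintegral_const_mul _ (by fun_prop), lintegral_exp_linear_pi,
        ← ENNReal.ofReal_mul (by positivity), ← ENNReal.ofReal_mul (by positivity), mul_assoc,
        ← Real.exp_add]
      congr 3
      simp only [mul_pow, ← Finset.mul_sum, ← Finset.sum_div]
      ring

lemma lintegral_exp_column_sq (n p : ℕ) (l : Fin p) (t : ℝ) (h : 2 * t / n < 1) :
    ∫⁻ X, ENNReal.ofReal (Real.exp (t * ∑ i, X i l ^ 2))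
        ∂(Measure.pi fun _ : Fin n => Measure.pi fun _ : Fin p => gaussianReal 0 (n : ℝ≥0)⁻¹) =
      ENNReal.ofReal ((Real.sqrt (1 - 2 * t / n))⁻¹ ^ n) := by
  have hmap : (Measure.pi fun _ : Fin n =>
      Measure.pi fun _ : Fin p => gaussianReal 0 (n : ℝ≥0)⁻¹).map (fun X i => X i l) =
      Measure.pi fun _ : Fin n => gaussianReal 0 (n : ℝ≥0)⁻¹ := by
    have he : ((Measure.pi fun _ : Fin p => gaussianReal 0 (n : ℝ≥0)⁻¹).map fun x => x l) =
        gaussianReal 0 (n : ℝ≥0)⁻¹ := (measurePreserving_eval _ l).map_eq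
    have := Measure.pi_map_pi (μ := fun _ : Fin n =>
      Measure.pi fun _ : Fin p => gaussianReal 0 (n : ℝ≥0)⁻¹) (f := fun _ x => x l)
      (hμ := fun _ => by rw [he]; infer_instance) (fun i => (measurable_pi_apply l).aemeasurable)
    rw [this, he]
  have h2 := lintegral_exp_sum_sq_pi (ι := Fin n) (n : ℝ≥0)⁻¹ t
    (by push_cast; rwa [← div_eq_mul_inv])
  rw [← hmap, lintegral_map (by fun_prop) (by fun_prop)] at h2
  rw [h2]
  simp [div_eq_mul_inv]

lemma bayes_lower_random_design {ι : Type*} [Fintype ι] [DecidableEq ι] {n p : ℕ}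
    (e : ι → Fin p) (x : (Fin n → Fin p → ℝ) × (Fin n → ℝ) → ι → ℝ) (hx : Measurable x)
    (a b s γ : ℝ) (hs : 0 ≤ s) (hn : (s ^ 2 + s) * b ^ 2 / n < 1) :
    ENNReal.ofReal (a ^ 2) * Fintype.card ι ≤
      (∑ J, ∫⁻ ω, ENNReal.ofReal
        (∑ j, (x (ω.1, fun i => ω.2 i + b * ω.1 i (e J)) j - if j = J then a else 0) ^ 2)
        ∂(model n p)) +
      ENNReal.ofReal (a ^ 2 * Real.exp γ) + Fintype.card ι * (
        ENNReal.ofReal (a ^ 2 * Real.exp (-(s * γ))) *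
          ENNReal.ofReal ((Real.sqrt (1 - (s ^ 2 + s) * b ^ 2 / n))⁻¹ ^ n)) := by
  set PX := Measure.pi fun _ : Fin n => Measure.pi fun _ : Fin p => gaussianReal 0 (n : ℝ≥0)⁻¹
  have hxj : ∀ j, Measurable fun z => x z j := fun j => (measurable_pi_apply j).comp hx
  have hfix := fun X : Fin n → Fin p → ℝ => bayes_lower_fixed_design (n := n)
    (fun J i => b * X i (e J)) (fun v => x (X, v)) (by fun_prop) a s γ hs
  have hlint := lintegral_mono (μ := PX) hfix
  have hcomp : ∀ J j, Measurable fun ω : (Fin n → Fin p → ℝ) × (Fin n → ℝ) =>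
      x (ω.1, fun i => ω.2 i + b * ω.1 i (e J)) j := fun J j =>
    (hxj j).comp (by fun_prop)
  have hmeas : ∀ J, Measurable fun ω : (Fin n → Fin p → ℝ) × (Fin n → ℝ) => ENNReal.ofReal
      (∑ j, (x (ω.1, fun i => ω.2 i + b * ω.1 i (e J)) j - if j = J then a else 0) ^ 2) :=
    fun J => by
      have := hcomp J
      fun_prop
  have hmeas' : ∀ J, Measurable fun X : Fin n → Fin p → ℝ => ∫⁻ z, ENNReal.ofReal
      (∑ j, (x (X, fun i => z i + b * X i (e J)) j - if j = J then a else 0) ^ 2)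
      ∂(Measure.pi fun _ : Fin n => gaussianReal 0 1) := fun J => (hmeas J).lintegral_prod_right'
  rw [lintegral_const, measure_univ, mul_one, lintegral_add_left (by fun_prop),
    lintegral_add_left (by fun_prop), lintegral_finsetSum _ (fun J _ => hmeas' J),
    lintegral_finsetSum _ (fun J _ => by fun_prop)] at hlint
  refine hlint.trans (le_of_eq ?_)
  congr 1
  · congr 1
    · refine Finset.sum_congr rfl fun J _ => ?_
      rw [model, lintegral_prod _ (hmeas J).aemeasurable]
    · simp [PX]
  · rw [← nsmul_eq_mul, ← Finset.card_univ, ← Finset.sum_const]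
    refine Finset.sum_congr rfl fun J _ => ?_
    rw [lintegral_const_mul _ (by fun_prop)]
    congr 1
    have := lintegral_exp_column_sq n p (e J) ((s ^ 2 + s) / 2 * b ^ 2) (by
      rw [show 2 * ((s ^ 2 + s) / 2 * b ^ 2) = (s ^ 2 + s) * b ^ 2 by ring]; exact hn)
    rw [show 2 * ((s ^ 2 + s) / 2 * b ^ 2) = (s ^ 2 + s) * b ^ 2 by ring] at this
    rw [← this]
    refine lintegral_congr fun X => ?_
    congr 2
    simp only [mul_pow, ← Finset.mul_sum]
    ring

/-- The block-sparse signal with one entry `a` at position `e (b, J b)` in each block `b`. -/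
def blockSignal {k q p : ℕ} (e : Fin k × Fin q → Fin p) (a : ℝ) (J : Fin k → Fin q) : Fin p → ℝ :=
  fun l => ∑ b, if l = e (b, J b) then a else 0

lemma blockSignal_apply {k q p : ℕ} (e : Fin k × Fin q → Fin p) (he : Function.Injective e) (a : ℝ)
    (J : Fin k → Fin q) (b : Fin k) (j : Fin q) :
    blockSignal e a J (e (b, j)) = if j = J b then a else 0 := by
  rw [blockSignal, Finset.sum_eq_single b]
  · simp [he.eq_iff]
  · intro b' _ hb'
    simp [he.eq_iff, hb'.symm]
  · simp

lemma block_lower {n k q p : ℕ} (e : Fin k × Fin q → Fin p) (he : Function.Injective e)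
    (est : (Fin n → Fin p → ℝ) × (Fin n → ℝ) → Fin p → ℝ) (hest : Measurable est)
    (a σ s γ : ℝ) (hσ : 0 < σ) (hs : 0 ≤ s) (hn : (s ^ 2 + s) * (a / σ) ^ 2 / n < 1) (b : Fin k) :
    ENNReal.ofReal (a ^ 2) * Fintype.card (Fin k → Fin q) * q ≤
      (∑ J : Fin k → Fin q, ∫⁻ ω, ENNReal.ofReal (∑ j, (est (ω.1, fun i =>
        (∑ l, ω.1 i l * blockSignal e a J l) + σ * ω.2 i) (e (b, j)) -
          blockSignal e a J (e (b, j))) ^ 2) ∂(model n p)) * q +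
      Fintype.card (Fin k → Fin q) * (ENNReal.ofReal (a ^ 2 * Real.exp γ) + q * (
        ENNReal.ofReal (a ^ 2 * Real.exp (-(s * γ))) *
          ENNReal.ofReal ((Real.sqrt (1 - (s ^ 2 + s) * (a / σ) ^ 2 / n))⁻¹ ^ n))) := by
  set K := ENNReal.ofReal (a ^ 2 * Real.exp γ) + q * (
        ENNReal.ofReal (a ^ 2 * Real.exp (-(s * γ))) *
          ENNReal.ofReal ((Real.sqrt (1 - (s ^ 2 + s) * (a / σ) ^ 2 / n))⁻¹ ^ n)) with hK
  set E := Equiv.funSplitAt b (Fin q) with hE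
  set rest : ({b' // b' ≠ b} → Fin q) → Fin p → ℝ := fun r l =>
    ∑ b' : {b' // b' ≠ b}, if l = e (b', r b') then a else 0 with hrest
  have hsig : ∀ j r l, blockSignal e a (E.symm (j, r)) l =
      (if l = e (b, j) then a else 0) + rest r l := by
    intro j r l
    rw [blockSignal, Fintype.sum_eq_add_sum_subtype_ne _ b]
    congr 1
    · simp [hE]
    · refine Finset.sum_congr rfl fun b' _ => ?_
      have := b'.2
      simp [hE, this]
  have hinner : ∀ r : {b' // b' ≠ b} → Fin q, ENNReal.ofReal (a ^ 2) * q ≤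
      (∑ j : Fin q, ∫⁻ ω, ENNReal.ofReal (∑ j', (est (ω.1, fun i =>
        (∑ l, ω.1 i l * blockSignal e a (E.symm (j, r)) l) + σ * ω.2 i) (e (b, j')) -
          blockSignal e a (E.symm (j, r)) (e (b, j'))) ^ 2) ∂(model n p)) + K := by
    intro r
    have := bayes_lower_random_design (n := n) (fun j => e (b, j))
      (fun ω j => est (ω.1, fun i => (∑ l, ω.1 i l * rest r l) + σ * ω.2 i) (e (b, j)))
      (by
        refine measurable_pi_lambda _ fun j => ?_
        exact (measurable_pi_apply _).comp (hest.comp (by fun_prop)))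
      a (a / σ) s γ hs hn
    rw [Fintype.card_fin, add_assoc, ← hK] at this
    refine this.trans (le_of_eq ?_)
    congr 1
    refine Finset.sum_congr rfl fun j _ => lintegral_congr fun ω => ?_
    congr 1
    refine Finset.sum_congr rfl fun j' _ => ?_
    rw [blockSignal_apply e he]
    have h1 : (E.symm (j, r)) b = j := by simp [hE]
    rw [h1]
    congr 4
    ext i
    simp_rw [hsig, mul_add]
    rw [Finset.sum_add_distrib]
    simp
    field_simp
    ring
  have hcard : Fintype.card (Fin k → Fin q) = q * Fintype.card ({b' // b' ≠ b} → Fin q) := by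
    rw [Fintype.card_congr E, Fintype.card_prod, Fintype.card_fin]
  set Φ : (Fin k → Fin q) → ℝ≥0∞ := fun J => ∫⁻ ω, ENNReal.ofReal (∑ j', (est (ω.1, fun i =>
        (∑ l, ω.1 i l * blockSignal e a J l) + σ * ω.2 i) (e (b, j')) -
          blockSignal e a J (e (b, j'))) ^ 2) ∂(model n p) with hΦ
  have hsplit : ∑ J, Φ J = ∑ r, ∑ j, Φ (E.symm (j, r)) := by
    rw [← E.symm.sum_comp, Fintype.sum_prod_type_right]
  have hsum : ∑ _r : {b' // b' ≠ b} → Fin q, ENNReal.ofReal (a ^ 2) * q ≤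
      ∑ r, ((∑ j, Φ (E.symm (j, r))) + K) := Finset.sum_le_sum fun r _ => hinner r
  rw [Finset.sum_add_distrib, ← hsplit, Finset.sum_const, Finset.sum_const, Finset.card_univ,
    nsmul_eq_mul, nsmul_eq_mul] at hsum
  rw [hcard]
  push_cast
  calc ENNReal.ofReal (a ^ 2) * (q * Fintype.card ({b' // b' ≠ b} → Fin q)) * q
      = (Fintype.card ({b' // b' ≠ b} → Fin q) * (ENNReal.ofReal (a ^ 2) * q)) * q := by ring
    _ ≤ ((∑ J, Φ J) + Fintype.card ({b' // b' ≠ b} → Fin q) * K) * q := by gcongr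
    _ = _ := by ring

lemma blockSignal_eq_zero_of_notMem {k q p : ℕ} (e : Fin k × Fin q → Fin p) (a : ℝ)
    (J : Fin k → Fin q) (l : Fin p) (hl : l ∉ Finset.univ.image fun b => e (b, J b)) :
    blockSignal e a J l = 0 := by
  refine Finset.sum_eq_zero fun b _ => if_neg fun h => hl ?_
  exact Finset.mem_image.2 ⟨b, Finset.mem_univ b, h.symm⟩

lemma blockSignal_mem_Theta {k q p : ℕ} (e : Fin k × Fin q → Fin p) (he : Function.Injective e)
    (a τ : ℝ) (hat : a ^ 2 ≤ τ ^ 2) (J : Fin k → Fin q) : blockSignal e a J ∈ Theta p k τ := by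
  have hcard : (Finset.univ.image fun b => e (b, J b)).card ≤ k :=
    Finset.card_image_le.trans (by simp)
  constructor
  · refine (Finset.card_le_card fun l hl => ?_).trans hcard
    by_contra h
    exact (Finset.mem_filter.1 hl).2 (blockSignal_eq_zero_of_notMem e a J l h)
  · rw [← Finset.sum_subset (Finset.subset_univ (Finset.univ.image fun b => e (b, J b)))
      (fun l _ hl => by rw [blockSignal_eq_zero_of_notMem e a J l hl]; ring),
      Finset.sum_image (fun b _ b' _ h => (Prod.ext_iff.1 (he h)).1)]
    simp only [blockSignal_apply e he]
    simpa using mul_le_mul_of_nonneg_left hat (Nat.cast_nonneg k)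

lemma sum_block_le_risk {n k q p : ℕ} (e : Fin k × Fin q → Fin p) (he : Function.Injective e)
    (est : (Fin n → Fin p → ℝ) × (Fin n → ℝ) → Fin p → ℝ) (hest : Measurable est)
    (σ : ℝ) (β : Fin p → ℝ) :
    ∑ b, ∫⁻ ω, ENNReal.ofReal (∑ j, (est (ω.1, fun i => (∑ l, ω.1 i l * β l) + σ * ω.2 i)
      (e (b, j)) - β (e (b, j))) ^ 2) ∂(model n p) ≤ risk n p σ est β := by
  have hm : ∀ l, Measurable fun ω : (Fin n → Fin p → ℝ) × (Fin n → ℝ) =>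
      est (ω.1, fun i => (∑ l, ω.1 i l * β l) + σ * ω.2 i) l := fun l =>
    (measurable_pi_apply l).comp (hest.comp (by fun_prop))
  rw [← lintegral_finsetSum _ (fun b _ => by fun_prop), risk]
  refine lintegral_mono fun ω => ?_
  dsimp only
  rw [← ENNReal.ofReal_sum_of_nonneg (fun b _ => by positivity)]
  refine ENNReal.ofReal_le_ofReal ?_
  rw [← Fintype.sum_prod_type' (f := fun b j => (est (ω.1, fun i =>
    (∑ l, ω.1 i l * β l) + σ * ω.2 i) (e (b, j)) - β (e (b, j))) ^ 2)]
  simp only [Prod.mk.eta]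
  rw [← Finset.sum_image (s := Finset.univ) (g := e)
    (f := fun l => (est (ω.1, fun i => (∑ l, ω.1 i l * β l) + σ * ω.2 i) l - β l) ^ 2)
    (fun _ _ _ _ h => he h)]
  exact Finset.sum_le_sum_of_subset_of_nonneg (Finset.subset_univ _) fun _ _ _ => sq_nonneg _

lemma le_minimaxRisk {n k q p : ℕ} (e : Fin k × Fin q → Fin p) (he : Function.Injective e)
    (hq : 0 < q) (a σ τ s γ : ℝ) (hσ : 0 < σ) (hs : 0 ≤ s) (hat : a ^ 2 ≤ τ ^ 2)
    (hn : (s ^ 2 + s) * (a / σ) ^ 2 / n < 1) (hfin : minimaxRisk n p k τ σ ≠ ⊤) :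
    k * a ^ 2 * (1 - (Real.exp γ / q + Real.exp (-(s * γ)) *
      (Real.sqrt (1 - (s ^ 2 + s) * (a / σ) ^ 2 / n))⁻¹ ^ n)) ≤
      (minimaxRisk n p k τ σ).toReal := by
  set D := (Real.sqrt (1 - (s ^ 2 + s) * (a / σ) ^ 2 / n))⁻¹ ^ n with hD
  have hD0 : 0 ≤ D := by positivity
  set Q : ℝ≥0∞ := ((Fintype.card (Fin k → Fin q) : ℕ) : ℝ≥0∞) with hQ
  have hQ0 : Q ≠ 0 := by
    have : Nonempty (Fin q) := ⟨⟨0, hq⟩⟩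
    rw [hQ]
    exact_mod_cast Fintype.card_ne_zero
  have hQt : Q ≠ ⊤ := ENNReal.natCast_ne_top _
  have hq' : (0 : ℝ) < q := by exact_mod_cast hq
  set K : ℝ≥0∞ := ENNReal.ofReal (a ^ 2 * Real.exp γ) + q * (
    ENNReal.ofReal (a ^ 2 * Real.exp (-(s * γ))) * ENNReal.ofReal D) with hK
  have hKr : K = ENNReal.ofReal (a ^ 2 * (Real.exp γ + q * (Real.exp (-(s * γ)) * D))) := by
    rw [hK, ← ENNReal.ofReal_mul (by positivity), ← ENNReal.ofReal_natCast,
      ← ENNReal.ofReal_mul (by positivity), ← ENNReal.ofReal_add (by positivity) (by positivity)]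
    congr 1
    ring
  have key : ENNReal.ofReal (k * a ^ 2 * (1 - (Real.exp γ / q + Real.exp (-(s * γ)) * D))) ≤
      minimaxRisk n p k τ σ := by
    refine le_iInf₂ fun est hest => ?_
    set S := ⨆ β ∈ Theta p k τ, risk n p σ est β
    have hS : ∀ J : Fin k → Fin q, risk n p σ est (blockSignal e a J) ≤ S := fun J =>
      le_iSup₂ (f := fun β _ => risk n p σ est β) _ (blockSignal_mem_Theta e he a τ hat J)
    have hsum := Finset.sum_le_sum fun b (_ : b ∈ Finset.univ) =>
      block_lower e he est hest a σ s γ hσ hs hn b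
    rw [Finset.sum_const, Finset.sum_add_distrib, Finset.sum_const, ← Finset.sum_mul,
      Finset.sum_comm, Finset.card_univ, Fintype.card_fin, nsmul_eq_mul, nsmul_eq_mul] at hsum
    have h1 := Finset.sum_le_sum fun J (_ : J ∈ (Finset.univ : Finset (Fin k → Fin q))) =>
      (sum_block_le_risk e he est hest σ (blockSignal e a J)).trans (hS J)
    rw [Finset.sum_const, Finset.card_univ, nsmul_eq_mul] at h1
    have h2 : Q * (k * (ENNReal.ofReal (a ^ 2) * q)) ≤ Q * (S * q + k * K) := by
      calc Q * (k * (ENNReal.ofReal (a ^ 2) * q)) = k * (ENNReal.ofReal (a ^ 2) * Q * q) := by ring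
        _ ≤ _ := hsum
        _ ≤ Q * S * q + k * (Q * K) := by gcongr
        _ = _ := by ring
    have h3 := (ENNReal.mul_le_mul_iff_right hQ0 hQt).1 h2
    rcases eq_or_ne S ⊤ with hSt | hSt
    · rw [hSt]
      exact le_top
    · rw [← ENNReal.ofReal_toReal hSt] at h3 ⊢
      refine ENNReal.ofReal_le_ofReal ?_
      rw [hKr, ← ENNReal.ofReal_natCast, ← ENNReal.ofReal_natCast q,
        ← ENNReal.ofReal_mul (by positivity), ← ENNReal.ofReal_mul (by positivity),
        ← ENNReal.ofReal_mul (by positivity), ← ENNReal.ofReal_mul (by positivity),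
        ← ENNReal.ofReal_add (by positivity) (by positivity),
        ENNReal.ofReal_le_ofReal_iff (by positivity)] at h3
      have h4 : k * a ^ 2 * (1 - (Real.exp γ / q + Real.exp (-(s * γ)) * D)) * q ≤
          S.toReal * q := by
        have : k * a ^ 2 * (1 - (Real.exp γ / q + Real.exp (-(s * γ)) * D)) * q =
          k * (a ^ 2 * q) - k * (a ^ 2 * (Real.exp γ + q * (Real.exp (-(s * γ)) * D))) := by
          field_simp
        linarith
      exact le_of_mul_le_mul_right h4 hq'
  exact (ENNReal.ofReal_le_iff_le_toReal hfin).1 key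

lemma inv_sqrt_one_sub_pow_le (n : ℕ) (hn : 0 < n) (x : ℝ) (h : x / n < 1) :
    (Real.sqrt (1 - x / n))⁻¹ ^ n ≤ Real.exp (x / 2 / (1 - x / n)) := by
  have hn' : (0 : ℝ) < n := by exact_mod_cast hn
  have hd : 0 < 1 - x / n := by linarith
  have h1 : (1 - x / n)⁻¹ ≤ Real.exp (x / n / (1 - x / n)) := by
    have := Real.add_one_le_exp (x / n / (1 - x / n))
    refine le_of_eq_of_le ?_ this
    rw [inv_eq_one_div, div_add_one hd.ne']
    congr 1
    ring
  have h2 : (Real.sqrt (1 - x / n))⁻¹ ≤ Real.exp (x / n / (1 - x / n) / 2) := by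
    rw [← Real.sqrt_inv, Real.exp_half]
    exact Real.sqrt_le_sqrt h1
  calc (Real.sqrt (1 - x / n))⁻¹ ^ n ≤ Real.exp (x / n / (1 - x / n) / 2) ^ n := by gcongr
    _ = _ := by
      rw [← Real.exp_nat_mul]
      congr 1
      field_simp

lemma tendsto_log_div_atTop (k p : ℕ → ℕ) (hk : ∀ n, 0 < k n) (hkp : ∀ n, k n ≤ p n)
    (hkp0 : Tendsto (fun n => (k n : ℝ) / p n) atTop (nhds 0)) :
    Tendsto (fun n => Real.log ((p n : ℝ) / k n)) atTop atTop := by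
  have h : Tendsto (fun n => (k n : ℝ) / p n) atTop (nhdsWithin 0 (Set.Ioi 0)) := by
    refine tendsto_nhdsWithin_iff.2 ⟨hkp0, Eventually.of_forall fun n => ?_⟩
    have h1 := hk n
    have h2 := h1.trans_le (hkp n)
    have h3 : (0 : ℝ) < k n / p n := div_pos (Nat.cast_pos.2 h1) (Nat.cast_pos.2 h2)
    exact h3
  have h2 := Real.tendsto_log_atTop.comp (tendsto_inv_nhdsGT_zero.comp h)
  refine h2.congr fun n => ?_
  simp

lemma log_div_le_mul_log (k p : ℕ) (hk : 0 < k) (hkp : k ≤ p) :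
    Real.log ((p : ℝ) / k) ≤ k * Real.log p := by
  have hk1 : (1 : ℝ) ≤ k := by exact_mod_cast hk
  have hp1 : (1 : ℝ) ≤ p := by exact_mod_cast hk.trans_le hkp
  rw [Real.log_div (by positivity) (by positivity)]
  nlinarith [Real.log_nonneg hk1, Real.log_nonneg hp1]

lemma tendsto_log_div_div (k p : ℕ → ℕ) (hk : ∀ n, 0 < k n) (hkp : ∀ n, k n ≤ p n)
    (hklogp : Tendsto (fun n => (k n : ℝ) * Real.log (p n) / n) atTop (nhds 0)) :
    Tendsto (fun n => Real.log ((p n : ℝ) / k n) / n) atTop (nhds 0) := by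
  refine squeeze_zero (fun n => ?_) (fun n => ?_) hklogp
  · refine div_nonneg (Real.log_nonneg ?_) (Nat.cast_nonneg n)
    rw [le_div_iff₀ (by exact_mod_cast hk n), one_mul]
    exact_mod_cast hkp n
  · gcongr
    exact log_div_le_mul_log _ _ (hk n) (hkp n)

lemma eventually_lt_minimaxRisk_ratio (k p : ℕ → ℕ) (τ σ : ℕ → ℝ)
    (hk : ∀ n, 0 < k n) (hkp : ∀ n, k n ≤ p n) (hσ : ∀ n, 0 < σ n)
    (hkp0 : Tendsto (fun n => (k n : ℝ) / p n) atTop (nhds 0))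
    (hklogp : Tendsto (fun n => (k n : ℝ) * Real.log (p n) / n) atTop (nhds 0))
    (hμ : Tendsto (fun n => (τ n / σ n) / Real.sqrt (Real.log ((p n : ℝ) / k n)))
      atTop atTop)
    (hfin : ∀ᶠ n in atTop, minimaxRisk n (p n) (k n) (τ n) (σ n) ≠ ⊤) {c : ℝ} (hc : c < 1) :
    ∀ᶠ n in atTop, c < (minimaxRisk n (p n) (k n) (τ n) (σ n)).toReal /
        (2 * σ n ^ 2 * k n * Real.log ((p n : ℝ) / k n)) := by
  set Λ : ℕ → ℝ := fun n => Real.log ((p n : ℝ) / k n) with hΛ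
  have hΛtop : Tendsto Λ atTop atTop := tendsto_log_div_atTop k p hk hkp hkp0
  have hΛn : Tendsto (fun n => Λ n / n) atTop (nhds 0) := tendsto_log_div_div k p hk hkp hklogp
  obtain ⟨ε, hε0, hε1, hεc⟩ : ∃ ε : ℝ, 0 < ε ∧ ε < 1 ∧ c < (1 - ε) ^ 2 := by
    have : Tendsto (fun ε : ℝ => (1 - ε) ^ 2) (nhdsWithin 0 (Set.Ioi 0)) (nhds 1) := by
      have h : Continuous fun ε : ℝ => (1 - ε) ^ 2 := by fun_prop
      simpa using (h.tendsto 0).mono_left nhdsWithin_le_nhds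
    obtain ⟨ε, h1, h2⟩ := ((this.eventually (lt_mem_nhds hc)).and
      (Ioo_mem_nhdsGT (zero_lt_one : (0 : ℝ) < 1))).exists
    exact ⟨ε, h2.1, h2.2, h1⟩
  set t : ℕ → ℝ := fun n => (ε ^ 2 + ε) * (2 * (1 - ε) ^ 2 * Λ n) / n with ht
  have ht0 : Tendsto t atTop (nhds 0) := by
    have := hΛn.const_mul ((ε ^ 2 + ε) * (2 * (1 - ε) ^ 2))
    rw [mul_zero] at this
    refine this.congr fun n => ?_
    simp only [ht]
    ring
  set g : ℕ → ℝ := fun n => Λ n * ((ε ^ 2 + ε) * (1 - ε) ^ 2 / (1 - t n) - ε * (1 - ε)) with hg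
  have hg_bot : Tendsto g atTop atBot := by
    have h1 : Tendsto (fun n => (ε ^ 2 + ε) * (1 - ε) ^ 2 / (1 - t n) - ε * (1 - ε)) atTop
        (nhds ((ε ^ 2 + ε) * (1 - ε) ^ 2 / (1 - 0) - ε * (1 - ε))) :=
      (tendsto_const_nhds.div (tendsto_const_nhds.sub ht0) (by norm_num)).sub tendsto_const_nhds
    refine hΛtop.atTop_mul_neg ?_ h1
    have : (ε ^ 2 + ε) * (1 - ε) ^ 2 / (1 - 0) - ε * (1 - ε) = -(ε ^ 3 * (1 - ε)) := by ring
    rw [this]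
    have : 0 < 1 - ε := by linarith
    exact neg_neg_of_pos (by positivity)
  have hlim : Tendsto (fun n => (1 - ε) ^ 2 * (1 - (2 * Real.exp (-(ε * Λ n)) + Real.exp (g n))))
      atTop (nhds ((1 - ε) ^ 2 * (1 - (2 * 0 + 0)))) := by
    refine tendsto_const_nhds.mul (tendsto_const_nhds.sub (Tendsto.add (tendsto_const_nhds.mul ?_)
      (Real.tendsto_exp_atBot.comp hg_bot)))
    refine Real.tendsto_exp_atBot.comp (tendsto_neg_atTop_atBot.comp ?_)
    exact hΛtop.const_mul_atTop hε0
  have hev := hlim.eventually (lt_mem_nhds (a := c) (by simpa using hεc))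
  filter_upwards [hev, hfin, ht0.eventually (gt_mem_nhds zero_lt_one),
    hΛtop.eventually_gt_atTop 0, hμ.eventually_ge_atTop 2,
    eventually_gt_atTop 0] with n h1 hfin ht1 hΛ0 hμ2 hn0
  refine h1.trans_le ?_
  have hk' : (0 : ℝ) < k n := by exact_mod_cast hk n
  have hp' : (0 : ℝ) < p n := by exact_mod_cast (hk n).trans_le (hkp n)
  have hσ' := hσ n
  set q := p n / k n with hq
  have hq0 : 0 < q := Nat.div_pos (hkp n) (hk n)
  have hq' : (0 : ℝ) < q := by exact_mod_cast hq0
  have hpq : (p n : ℝ) / k n ≤ 2 * q := by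
    rw [div_le_iff₀ hk']
    have h2 : p n < k n * (q + 1) := Nat.lt_mul_div_succ _ (hk n)
    have h3 : p n ≤ 2 * q * k n := by nlinarith [hk n]
    exact_mod_cast h3
  set a := σ n * (1 - ε) * Real.sqrt (2 * Λ n) with ha
  have ha2 : a ^ 2 = σ n ^ 2 * (2 * (1 - ε) ^ 2 * Λ n) := by
    rw [ha, mul_pow, mul_pow, Real.sq_sqrt (by positivity)]
    ring
  have haσ : (a / σ n) ^ 2 = 2 * (1 - ε) ^ 2 * Λ n := by
    rw [div_pow, ha2]
    field_simp
  have hat : a ^ 2 ≤ τ n ^ 2 := by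
    rw [le_div_iff₀ (Real.sqrt_pos.2 hΛ0), le_div_iff₀ hσ'] at hμ2
    have h2 : (2 * Real.sqrt (Λ n) * σ n) ^ 2 ≤ τ n ^ 2 := by gcongr
    rw [mul_pow, mul_pow, Real.sq_sqrt hΛ0.le] at h2
    have h3 : (1 - ε) ^ 2 ≤ 1 := by nlinarith
    have h4 : 0 < σ n ^ 2 * Λ n := by positivity
    rw [ha2]
    nlinarith
  have hinj : Function.Injective (fun x : Fin (k n) × Fin q =>
      Fin.castLE (Nat.mul_div_le (p n) (k n)) (finProdFinEquiv x)) :=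
    (Fin.castLE_injective _).comp finProdFinEquiv.injective
  have hmain := le_minimaxRisk (n := n) _ hinj hq0 a (σ n) (τ n) ε ((1 - ε) * Λ n) hσ' hε0.le hat
    (by rw [haσ]; exact ht1) hfin
  rw [le_div_iff₀ (by positivity)]
  refine le_trans ?_ hmain
  rw [ha2]
  have e1 : Real.exp ((1 - ε) * Λ n) / q ≤ 2 * Real.exp (-(ε * Λ n)) := by
    rw [div_le_iff₀ hq', show (1 - ε) * Λ n = -(ε * Λ n) + Λ n by ring, Real.exp_add, hΛ,
      Real.exp_log (by positivity)]
    nlinarith [Real.exp_pos (-(ε * Λ n))]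
  have e2 : Real.exp (-(ε * ((1 - ε) * Λ n))) *
      (Real.sqrt (1 - (ε ^ 2 + ε) * (a / σ n) ^ 2 / n))⁻¹ ^ n ≤ Real.exp (g n) := by
    rw [haσ]
    refine (mul_le_mul_of_nonneg_left (inv_sqrt_one_sub_pow_le n hn0 _ ht1)
      (Real.exp_pos _).le).trans (le_of_eq ?_)
    rw [← Real.exp_add]
    congr 1
    simp only [hg, ht]
    ring
  have hpos : 0 ≤ k n * (σ n ^ 2 * (2 * (1 - ε) ^ 2 * Λ n)) := by positivity
  have := mul_le_mul_of_nonneg_left (sub_le_sub_left (add_le_add e1 e2) 1) hpos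
  refine le_trans (le_of_eq ?_) this
  simp only [hΛ]
  ring

/-! ### Upper bound: laws of the data rows -/

/-- Joint law of one row of the design matrix and the corresponding noise variable. -/
def rowLaw (n p : ℕ) : Measure ((Fin p → ℝ) × ℝ) :=
  (Measure.pi fun _ : Fin p => gaussianReal 0 (n : ℝ≥0)⁻¹).prod (gaussianReal 0 1)

instance (n p : ℕ) : IsProbabilityMeasure (rowLaw n p) := by
  unfold rowLaw
  infer_instance

lemma lintegral_model_eq_rows (n p : ℕ) (P : Fin n → Prop) [DecidablePred P]
    (f : ({i // P i} → (Fin p → ℝ) × ℝ) → ({i // ¬ P i} → (Fin p → ℝ) × ℝ) → ℝ≥0∞)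
    (hf : Measurable (Function.uncurry f)) :
    ∫⁻ ω, f (fun i => (ω.1 i, ω.2 i)) (fun i => (ω.1 i, ω.2 i)) ∂(model n p) =
      ∫⁻ A, ∫⁻ B, f A B ∂(Measure.pi fun _ => rowLaw n p) ∂(Measure.pi fun _ => rowLaw n p) := by
  have h1 := (measurePreserving_arrowProdEquivProdArrow (Fin p → ℝ) ℝ (Fin n)
    (fun _ => Measure.pi fun _ : Fin p => gaussianReal 0 (n : ℝ≥0)⁻¹)
    (fun _ => gaussianReal 0 1)).symm
  have h2 := measurePreserving_piEquivPiSubtypeProd (fun _ : Fin n => rowLaw n p) P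
  have h3 := (h2.comp h1).lintegral_comp hf
  rw [lintegral_prod _ hf.aemeasurable] at h3
  exact h3

lemma map_linear_pi_prod_gaussianReal {ι : Type*} [Fintype ι] (v w : ℝ≥0) (c : ι → ℝ) (σ : ℝ) :
    ((gaussianReal 0 (Real.toNNReal (∑ l, c l ^ 2 * v))).prod (gaussianReal 0 w)).map
      (fun u => u.1 + σ * u.2) =
      gaussianReal 0 (Real.toNNReal (∑ l, c l ^ 2 * v + σ ^ 2 * w)) := by
  have h1 : ((gaussianReal 0 (Real.toNNReal (∑ l, c l ^ 2 * v))).prod (gaussianReal 0 w)).map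
      (fun u => u.1 + σ * u.2) = ((gaussianReal 0 (Real.toNNReal (∑ l, c l ^ 2 * v))).prod
        ((gaussianReal 0 w).map (σ * ·))).map (fun u => u.1 + u.2) := by
    conv_rhs => rw [← Measure.map_id (μ := gaussianReal 0 (Real.toNNReal (∑ l, c l ^ 2 * v)))]
    rw [Measure.map_prod_map _ _ measurable_id (by fun_prop),
      Measure.map_map (by fun_prop) (by fun_prop)]
    rfl
  rw [h1, gaussianReal_map_const_mul]
  have h2 := gaussianReal_conv_gaussianReal (m₁ := 0) (m₂ := σ * 0)
    (v₁ := Real.toNNReal (∑ l, c l ^ 2 * v)) (v₂ := .mk (σ ^ 2) (sq_nonneg _) * w)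
  rw [Measure.conv] at h2
  rw [h2]
  congr 1
  · simp
  · rw [Real.toNNReal_add (Finset.sum_nonneg fun _ _ => by positivity) (by positivity)]
    congr 1
    ext
    rw [Real.coe_toNNReal _ (by positivity)]
    simp

lemma rowLaw_map_linear (n p : ℕ) (c : Fin p → ℝ) (σ : ℝ) :
    (rowLaw n p).map (fun w => ∑ l, c l * w.1 l + σ * w.2) =
      gaussianReal 0 (Real.toNNReal ((∑ l, c l ^ 2) / n + σ ^ 2)) := by
  have h := map_linear_pi_prod_gaussianReal (n : ℝ≥0)⁻¹ 1 c σ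
  rw [← map_linear_pi_gaussianReal (fun _ => (n : ℝ≥0)⁻¹) c] at h
  conv_lhs at h => rw [← Measure.map_id (μ := gaussianReal 0 1)]
  rw [Measure.map_prod_map _ _ (by fun_prop) measurable_id,
    Measure.map_map (by fun_prop) (by fun_prop)] at h
  refine h.trans ?_
  congr 2
  simp [← Finset.sum_mul, div_eq_mul_inv]

lemma rowLaw_map_coord_linear (n p : ℕ) (j : Fin p) (c : Fin p → ℝ) (hc : c j = 0) (σ : ℝ) :
    (rowLaw n p).map (fun w => (w.1 j, ∑ l, c l * w.1 l + σ * w.2)) =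
      (gaussianReal 0 (n : ℝ≥0)⁻¹).prod
        (gaussianReal 0 (Real.toNNReal ((∑ l, c l ^ 2) / n + σ ^ 2))) := by
  set π := Measure.pi fun _ : Fin p => gaussianReal 0 (n : ℝ≥0)⁻¹ with hπ
  set γ := gaussianReal 0 (n : ℝ≥0)⁻¹ with hγ
  have hpair : π.map (fun x => (x j, ∑ l, c l * x l)) =
      γ.prod (gaussianReal 0 (Real.toNNReal (∑ l, c l ^ 2 * (n : ℝ≥0)⁻¹))) := by
    have hind : IndepFun (fun x : Fin p → ℝ => x j) (fun x => ∑ l, c l * x l) π := by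
      have h1 : iIndepFun (fun l (x : Fin p → ℝ) => (if l = j then 1 else c l) * x l) π :=
        iIndepFun_pi (X := fun l (t : ℝ) => (if l = j then 1 else c l) * t)
          fun l => by fun_prop
      have h2 := (h1.indepFun_finsetSum_of_notMem (fun l => by fun_prop)
        (Finset.notMem_erase j Finset.univ)).symm
      convert h2 using 1
      · ext x
        simp
      · ext x
        rw [Finset.sum_apply, ← Finset.add_sum_erase _ _ (Finset.mem_univ j), hc, zero_mul,
          zero_add]
        refine Finset.sum_congr rfl fun l hl => ?_
        rw [if_neg (Finset.ne_of_mem_erase hl)]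
    have hm : Measurable fun x : Fin p → ℝ => ∑ l, c l * x l := by fun_prop
    rw [(indepFun_iff_map_prod_eq_prod_map_map (measurable_pi_apply j).aemeasurable
      hm.aemeasurable).1 hind, map_linear_pi_gaussianReal, (measurePreserving_eval _ j).map_eq]
  have h := map_linear_pi_prod_gaussianReal (n : ℝ≥0)⁻¹ 1 c σ
  have h3 : (∑ l, c l ^ 2) / n + σ ^ 2 =
      ∑ l, c l ^ 2 * ((n : ℝ≥0)⁻¹ : ℝ≥0) + σ ^ 2 * (1 : ℝ≥0) := by
    simp [← Finset.sum_mul, div_eq_mul_inv]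
  rw [h3, ← h]
  conv_rhs => rw [← Measure.map_id (μ := γ)]
  rw [Measure.map_prod_map _ _ measurable_id (by fun_prop), ← Measure.prodAssoc_prod,
    Measure.map_map (by fun_prop) (by fun_prop)]
  push_cast at hpair ⊢
  rw [← hpair]
  conv_rhs => rw [← Measure.map_id (μ := gaussianReal 0 1)]
  rw [Measure.map_prod_map _ _ (by fun_prop) measurable_id,
    Measure.map_map (by fun_prop) (by fun_prop)]
  rfl

/-! ### Upper bound: least-squares selection from a finite set -/

/-- The observed row `(x, ⟨x, β⟩ + σ z)` obtained from the pair `(x, z)`. -/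
def rowData {p : ℕ} (σ : ℝ) (β : Fin p → ℝ) (w : (Fin p → ℝ) × ℝ) : (Fin p → ℝ) × ℝ :=
  (w.1, (∑ l, w.1 l * β l) + σ * w.2)

lemma measurable_rowData {p : ℕ} (σ : ℝ) (β : Fin p → ℝ) : Measurable (rowData σ β) := by
  unfold rowData
  fun_prop

/-- The residual sum of squares of `b` on the observed rows `A`. -/
def sumSqResid {ι : Type*} [Fintype ι] {p : ℕ} (b : Fin p → ℝ) (A : ι → (Fin p → ℝ) × ℝ) : ℝ :=
  ∑ i, ((A i).2 - ∑ l, (A i).1 l * b l) ^ 2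

lemma measurable_sumSqResid {ι : Type*} [Fintype ι] {p : ℕ} (b : Fin p → ℝ) :
    Measurable (sumSqResid b : (ι → (Fin p → ℝ) × ℝ) → ℝ) := by
  unfold sumSqResid
  fun_prop

lemma exists_measurable_argmin {Ω E : Type*} [MeasurableSpace Ω] [MeasurableSpace E]
    (G : Finset E) (hG : G.Nonempty) (f : E → Ω → ℝ) (hf : ∀ b, Measurable (f b)) :
    ∃ sel : Ω → E, Measurable sel ∧ ∀ ω, sel ω ∈ G ∧ ∀ b ∈ G, f (sel ω) ω ≤ f b ω := by
  suffices H : ∃ sel : Ω → E, Measurable sel ∧ Measurable (fun ω => f (sel ω) ω) ∧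
      ∀ ω, sel ω ∈ G ∧ ∀ b ∈ G, f (sel ω) ω ≤ f b ω by
    obtain ⟨sel, h1, -, h2⟩ := H
    exact ⟨sel, h1, h2⟩
  induction hG using Finset.Nonempty.cons_induction with
  | singleton a => exact ⟨fun _ => a, measurable_const, hf a, by simp⟩
  | cons a s ha hs ih =>
    obtain ⟨sel, h1, h2, h3⟩ := ih
    classical
    have hset : MeasurableSet {ω | f a ω ≤ f (sel ω) ω} := measurableSet_le (hf a) h2
    refine ⟨fun ω => if f a ω ≤ f (sel ω) ω then a else sel ω,
      Measurable.ite hset measurable_const h1, ?_, fun ω => ?_⟩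
    · have : (fun ω => f (if f a ω ≤ f (sel ω) ω then a else sel ω) ω) =
          fun ω => min (f a ω) (f (sel ω) ω) := by
        ext ω
        split_ifs with h
        · rw [min_eq_left h]
        · rw [min_eq_right (le_of_not_ge h)]
      rw [this]
      exact (hf a).min h2
    · obtain ⟨h4, h5⟩ := h3 ω
      dsimp only
      split_ifs with h
      · refine ⟨Finset.mem_cons_self a s, fun b hb => ?_⟩
        rcases Finset.mem_cons.1 hb with rfl | hb
        · exact le_rfl
        · exact h.trans (h5 b hb)
      · refine ⟨Finset.mem_cons_of_mem h4, fun b hb => ?_⟩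
        rcases Finset.mem_cons.1 hb with rfl | hb
        · exact le_of_not_ge h
        · exact h5 b hb

lemma lintegral_mul_sq_le {Ω : Type*} [MeasurableSpace Ω] (μ : Measure Ω) (f g : Ω → ℝ≥0∞)
    (hf : Measurable f) (hg : Measurable g) :
    (∫⁻ ω, f ω * g ω ∂μ) ^ 2 ≤ (∫⁻ ω, f ω ^ 2 ∂μ) * ∫⁻ ω, g ω ^ 2 ∂μ := by
  have h := ENNReal.lintegral_mul_le_Lp_mul_Lq μ Real.HolderConjugate.two_two
    hf.aemeasurable hg.aemeasurable
  have h2 := pow_le_pow_left' h 2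
  rw [mul_pow] at h2
  simp only [← ENNReal.rpow_natCast, ← ENNReal.rpow_mul] at h2 ⊢
  simpa using h2

lemma lintegral_exp_sq_resid (n p : ℕ) (σ : ℝ) (β b : Fin p → ℝ) (t : ℝ)
    (h : 2 * t * ((∑ l, (β l - b l) ^ 2) / n + σ ^ 2) < 1) :
    ∫⁻ w, ENNReal.ofReal (Real.exp (t * ((rowData σ β w).2 - ∑ l, (rowData σ β w).1 l * b l) ^ 2))
      ∂(rowLaw n p) =
      ENNReal.ofReal (Real.sqrt (1 - 2 * t * ((∑ l, (β l - b l) ^ 2) / n + σ ^ 2)))⁻¹ := by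
  have h0 : 0 ≤ (∑ l, (β l - b l) ^ 2) / n + σ ^ 2 := by positivity
  have h1 := lintegral_exp_sq_gaussianReal
    (Real.toNNReal ((∑ l, (β l - b l) ^ 2) / n + σ ^ 2)) t (by rwa [Real.coe_toNNReal _ h0])
  rw [← rowLaw_map_linear, lintegral_map (by fun_prop) (by fun_prop),
    Real.coe_toNNReal _ h0] at h1
  rw [← h1]
  refine lintegral_congr fun w => ?_
  congr 4
  simp only [rowData, sub_mul, Finset.sum_sub_distrib, mul_comm (w.1 _)]
  ring

lemma measure_selection_le {ι : Type*} [Fintype ι] (n p M : ℕ) (hι : Fintype.card ι = 4 * M)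
    (σ : ℝ) (β b b₀ : Fin p → ℝ) (t : ℝ) (ht : 0 ≤ t)
    (h₀ : 4 * t * ((∑ l, (β l - b₀ l) ^ 2) / n + σ ^ 2) < 1)
    (E : Set (ι → (Fin p → ℝ) × ℝ))
    (hE : ∀ A ∈ E, sumSqResid b (fun i => rowData σ β (A i)) ≤
      sumSqResid b₀ (fun i => rowData σ β (A i))) :
    (Measure.pi fun _ : ι => rowLaw n p) E ≤ ENNReal.ofReal
      (((1 - 4 * t * ((∑ l, (β l - b₀ l) ^ 2) / n + σ ^ 2)) *
        (1 + 4 * t * ((∑ l, (β l - b l) ^ 2) / n + σ ^ 2)))⁻¹ ^ M) := by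
  set s₀ := (∑ l, (β l - b₀ l) ^ 2) / n + σ ^ 2 with hs₀
  set s := (∑ l, (β l - b l) ^ 2) / n + σ ^ 2 with hs
  have hs0 : 0 ≤ s := by positivity
  have hrm := measurable_rowData σ β
  set v : (Fin p → ℝ) → (Fin p → ℝ) × ℝ → ℝ := fun b w =>
    (rowData σ β w).2 - ∑ l, (rowData σ β w).1 l * b l with hv
  have hvm : ∀ b, Measurable (v b) := fun b => by fun_prop
  have hrow : (∫⁻ w, ENNReal.ofReal (Real.exp (t * v b₀ w ^ 2)) *
      ENNReal.ofReal (Real.exp (-t * v b w ^ 2)) ∂(rowLaw n p)) ^ 2 ≤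
      ENNReal.ofReal (Real.sqrt (1 - 4 * t * s₀))⁻¹ * ENNReal.ofReal (Real.sqrt (1 + 4 * t * s))⁻¹ := by
    refine (lintegral_mul_sq_le _ _ _ (by fun_prop) (by fun_prop)).trans (le_of_eq ?_)
    have e : ∀ (t u : ℝ), ENNReal.ofReal (Real.exp (t * u)) ^ 2 =
        ENNReal.ofReal (Real.exp ((2 * t) * u)) := by
      intro t u
      rw [← ENNReal.ofReal_pow (Real.exp_pos _).le, ← Real.exp_nat_mul]
      congr 2
      push_cast
      ring
    simp_rw [e]
    rw [lintegral_exp_sq_resid n p σ β b₀ (2 * t) (by linarith),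
      lintegral_exp_sq_resid n p σ β b (2 * -t) (by nlinarith [mul_nonneg ht hs0])]
    congr 4 <;> ring
  have hmark : (Measure.pi fun _ : ι => rowLaw n p) E ≤
      ∫⁻ A, ∏ i, (ENNReal.ofReal (Real.exp (t * v b₀ (A i) ^ 2)) *
        ENNReal.ofReal (Real.exp (-t * v b (A i) ^ 2))) ∂(Measure.pi fun _ : ι => rowLaw n p) := by
    refine (measure_mono (t := {A | 1 ≤ ∏ i, (ENNReal.ofReal (Real.exp (t * v b₀ (A i) ^ 2)) *
        ENNReal.ofReal (Real.exp (-t * v b (A i) ^ 2)))}) fun A hA => ?_).trans ?_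
    · have h1 := hE A hA
      simp only [Set.mem_ofPred_eq, ← ENNReal.ofReal_mul (Real.exp_pos _).le, ← Real.exp_add]
      rw [← ENNReal.ofReal_prod_of_nonneg (fun i _ => (Real.exp_pos _).le), ← Real.exp_sum,
        ENNReal.one_le_ofReal, Real.one_le_exp_iff, Finset.sum_add_distrib, ← Finset.mul_sum,
        ← Finset.mul_sum]
      simp only [sumSqResid] at h1
      have h2 := mul_le_mul_of_nonneg_left h1 ht
      linarith
    · have h1 := mul_meas_ge_le_lintegral₀ (μ := Measure.pi fun _ : ι => rowLaw n p)
        (f := fun A => ∏ i, (ENNReal.ofReal (Real.exp (t * v b₀ (A i) ^ 2)) *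
          ENNReal.ofReal (Real.exp (-t * v b (A i) ^ 2)))) (Measurable.aemeasurable (by fun_prop)) 1
      rwa [one_mul] at h1
  refine hmark.trans ?_
  rw [lintegral_pi_prod (fun _ : ι => rowLaw n p)
    (fun _ w => ENNReal.ofReal (Real.exp (t * v b₀ w ^ 2)) *
      ENNReal.ofReal (Real.exp (-t * v b w ^ 2))) (fun _ => by fun_prop), Finset.prod_const,
    Finset.card_univ, hι, show 4 * M = 2 * (2 * M) by ring, pow_mul]
  refine (pow_le_pow_left' hrow _).trans (le_of_eq ?_)
  rw [← ENNReal.ofReal_mul (by positivity), ← ENNReal.ofReal_pow (by positivity), pow_mul]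
  congr 2
  rw [mul_pow, inv_pow, inv_pow, Real.sq_sqrt (by linarith), Real.sq_sqrt (by positivity), mul_inv]

lemma selection_bracket_ge (ε r₀ r : ℝ) (hε : 0 < ε) (hε1 : ε ≤ 1 / 4) (hr₀ : 0 ≤ r₀)
    (hr₀' : r₀ ≤ ε / 4) (hr : 4 * ε ≤ r) :
    1 + ε / 8 * r ≤ (1 - ε / 4 * (1 + r₀)) * (1 + ε / 4 * (1 + r)) := by
  have h1 : ε * (1 + r₀) * (1 + r) ≤ (17 / 16) * (r / 2) := by
    have h2 : ε * (1 + r) ≤ r / 2 := by nlinarith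
    have h3 : 0 ≤ ε * (1 + r) := by nlinarith
    nlinarith
  nlinarith

/-! ### Upper bound: summation over the sparse grid -/

lemma exists_sum_inv_one_add_sq_le : ∃ A₀ : ℝ, 0 < A₀ ∧ ∀ (κ t : ℝ) (S : Finset ℤ), 0 < κ → κ ≤ 1 →
    ∑ v ∈ S, (1 + κ * (v - t) ^ 2)⁻¹ ≤ A₀ / κ := by
  have hsum : Summable fun w : ℤ => 2 * (1 + (w : ℝ) ^ 2)⁻¹ := by
    refine Summable.of_nonneg_of_le (fun w => by positivity) (fun w => ?_)
      (((Real.summable_one_div_int_add_rpow (1 / 2) 2).2 one_lt_two).mul_left 4)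
    have h0 : (w : ℝ) + 1 / 2 ≠ 0 := by
      intro h
      have h1 : (2 * w + 1 : ℝ) = 0 := by linarith
      have h2 : 2 * w + 1 = 0 := by exact_mod_cast h1
      omega
    rw [Real.rpow_two, sq_abs, ← div_eq_mul_inv, mul_one_div, div_le_div_iff₀ (by positivity)
      (by positivity)]
    nlinarith [sq_nonneg ((w : ℝ) - 1 / 2)]
  refine ⟨∑' w : ℤ, 2 * (1 + (w : ℝ) ^ 2)⁻¹, ?_, ?_⟩
  · exact hsum.tsum_pos (fun w => by positivity) 0 (by norm_num)
  · intro κ t S hκ hκ1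
    have h1 : ∀ v ∈ S, (1 + κ * (v - t) ^ 2)⁻¹ ≤
        κ⁻¹ * (2 * (1 + ((v - round t : ℤ) : ℝ) ^ 2)⁻¹) := by
      intro v _
      have hr := abs_sub_round t
      have hr2 : (t - round t) ^ 2 ≤ (1 / 2) ^ 2 := sq_le_sq' (by linarith [neg_abs_le (t - round t)])
        ((le_abs_self _).trans hr)
      push_cast
      rw [← div_eq_mul_inv 2, inv_mul_eq_div, div_div, inv_eq_one_div, div_le_div_iff₀ (by positivity)
        (by positivity)]
      have h2 : 1 + ((v : ℝ) - round t) ^ 2 ≤ 2 * (1 + (v - t) ^ 2) := by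
        nlinarith [sq_nonneg ((v - t) - (t - round t))]
      nlinarith [mul_le_mul_of_nonneg_left h2 hκ.le]
    refine (Finset.sum_le_sum h1).trans ?_
    rw [← Finset.mul_sum, div_eq_inv_mul]
    refine mul_le_mul_of_nonneg_left ?_ (by positivity)
    rw [← Finset.sum_image (s := S) (g := fun v => v - round t)
      (f := fun w : ℤ => 2 * (1 + (w : ℝ) ^ 2)⁻¹) (fun _ _ _ _ h => by simpa using h)]
    exact hsum.sum_le_tsum _ (fun w _ => by positivity)

/-- Integer vectors with entries in `S` and at most `k` nonzero entries. -/
def sparseGrid (p k : ℕ) (S : Finset ℤ) : Finset (Fin p → ℤ) :=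
  (Fintype.piFinset fun _ => S).filter fun u => (Finset.univ.filter fun j => u j ≠ 0).card ≤ k

lemma sum_sparseGrid_le {A₀ : ℝ} (hA : ∀ (κ t : ℝ) (S : Finset ℤ), 0 < κ → κ ≤ 1 →
    ∑ v ∈ S, (1 + κ * (v - t) ^ 2)⁻¹ ≤ A₀ / κ) (p k : ℕ) (hp : 0 < p) (S : Finset ℤ)
    (κ : ℝ) (hκ : 0 < κ) (hκ1 : κ ≤ 1) (t : Fin p → ℝ) :
    ∑ u ∈ sparseGrid p k S, ((1 + κ * ∑ j, (u j - t j) ^ 2)⁻¹) ^ k ≤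
      (p : ℝ) ^ k * Real.exp (A₀ / κ) := by
  have hp1 : (1 : ℝ) ≤ p := by exact_mod_cast hp
  have hp0 : (0 : ℝ) < p := by linarith
  set g : Fin p → ℤ → ℝ := fun j v => if v = 0 then 1 else (p : ℝ)⁻¹ * (1 + κ * (v - t j) ^ 2)⁻¹ with hg
  have hg0 : ∀ j v, 0 ≤ g j v := by
    intro j v
    simp only [hg]
    split_ifs <;> positivity
  have hterm : ∀ u ∈ sparseGrid p k S, ((1 + κ * ∑ j, (u j - t j) ^ 2)⁻¹) ^ k ≤
      (p : ℝ) ^ k * ∏ j, g j (u j) := by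
    intro u hu
    have hcard := (Finset.mem_filter.1 hu).2
    set T := κ * ∑ j, (u j - t j) ^ 2 with hT
    have hT0 : 0 ≤ T := by positivity
    have hle : ∀ j, (p : ℝ)⁻¹ * (1 + T)⁻¹ ≤ (p : ℝ)⁻¹ * (1 + κ * (u j - t j) ^ 2)⁻¹ := by
      intro j
      gcongr
      exact mul_le_mul_of_nonneg_left (Finset.single_le_sum (f := fun j => (u j - t j) ^ 2)
        (fun _ _ => sq_nonneg _) (Finset.mem_univ j)) hκ.le
    have hq1 : (p : ℝ)⁻¹ * (1 + T)⁻¹ ≤ 1 :=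
      mul_le_one₀ (inv_le_one_of_one_le₀ hp1) (by positivity)
        (inv_le_one_of_one_le₀ (by linarith))
    have h1 : ((p : ℝ)⁻¹ * (1 + T)⁻¹) ^ k ≤ ∏ j, g j (u j) := by
      calc ((p : ℝ)⁻¹ * (1 + T)⁻¹) ^ k
          ≤ ((p : ℝ)⁻¹ * (1 + T)⁻¹) ^ (Finset.univ.filter fun j => u j ≠ 0).card :=
            pow_le_pow_of_le_one (by positivity) hq1 hcard
        _ ≤ ∏ j ∈ Finset.univ.filter fun j => u j ≠ 0,
              (p : ℝ)⁻¹ * (1 + κ * (u j - t j) ^ 2)⁻¹ := by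
            rw [← Finset.prod_const]
            exact Finset.prod_le_prod (fun _ _ => by positivity) fun j _ => hle j
        _ = ∏ j, g j (u j) := by
            rw [Finset.prod_filter]
            refine Finset.prod_congr rfl fun j _ => ?_
            simp only [hg, ne_eq, ite_not]
    calc ((1 + T)⁻¹) ^ k = (p : ℝ) ^ k * ((p : ℝ)⁻¹ * (1 + T)⁻¹) ^ k := by
          rw [mul_pow, ← mul_assoc, ← mul_pow, mul_inv_cancel₀ hp0.ne', one_pow, one_mul]
      _ ≤ _ := by gcongr
  refine (Finset.sum_le_sum hterm).trans ?_
  rw [← Finset.mul_sum]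
  refine mul_le_mul_of_nonneg_left ?_ (by positivity)
  calc ∑ u ∈ sparseGrid p k S, ∏ j, g j (u j)
      ≤ ∑ u ∈ Fintype.piFinset fun _ : Fin p => S, ∏ j, g j (u j) :=
        Finset.sum_le_sum_of_subset_of_nonneg (Finset.filter_subset _ _)
          fun u _ _ => Finset.prod_nonneg fun j _ => hg0 j _
    _ = ∏ j, ∑ v ∈ S, g j v := (Finset.prod_univ_sum (fun _ => S) g).symm
    _ ≤ ∏ _j : Fin p, Real.exp ((p : ℝ)⁻¹ * (A₀ / κ)) := by
        refine Finset.prod_le_prod (fun j _ => Finset.sum_nonneg fun v _ => hg0 j v) fun j _ => ?_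
        have h1 : ∀ v ∈ S, g j v ≤ (if v = 0 then 1 else 0) +
            (p : ℝ)⁻¹ * (1 + κ * (v - t j) ^ 2)⁻¹ := by
          intro v _
          simp only [hg]
          split_ifs
          · have : 0 ≤ (p : ℝ)⁻¹ * (1 + κ * (v - t j) ^ 2)⁻¹ := by positivity
            linarith
          · simp
        refine (Finset.sum_le_sum h1).trans ?_
        rw [Finset.sum_add_distrib, ← Finset.mul_sum, Finset.sum_ite_eq']
        refine le_trans ?_ (Real.add_one_le_exp _)
        rw [add_comm]
        refine add_le_add (mul_le_mul_of_nonneg_left (hA κ (t j) S hκ hκ1) (by positivity)) ?_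
        split_ifs <;> norm_num
    _ = Real.exp (A₀ / κ) := by
        rw [Finset.prod_const, ← Real.exp_nat_mul, Finset.card_univ, Fintype.card_fin]
        congr 1
        field_simp

/-! ### Upper bound: coordinatewise soft thresholding -/

/-- Soft thresholding of `x` at level `ℓ`. -/
def softThreshold (x ℓ : ℝ) : ℝ := x - max (-ℓ) (min x ℓ)

lemma softThreshold_sub_sq_le (θ g ℓ : ℝ) (hℓ : 0 ≤ ℓ) :
    (softThreshold (θ + g) ℓ - θ) ^ 2 ≤ (|g| + ℓ) ^ 2 := by
  have h1 : |max (-ℓ) (min (θ + g) ℓ)| ≤ ℓ :=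
    abs_le.2 ⟨le_max_left _ _, max_le (by linarith) (min_le_right _ _)⟩
  rw [← sq_abs]
  gcongr
  rw [softThreshold, show θ + g - max (-ℓ) (min (θ + g) ℓ) - θ = g - max (-ℓ) (min (θ + g) ℓ) by ring]
  exact (abs_sub _ _).trans (by linarith)

lemma softThreshold_sq_le (g ℓ : ℝ) (hℓ : 0 ≤ ℓ) :
    softThreshold g ℓ ^ 2 ≤ max (|g| - ℓ) 0 ^ 2 := by
  rw [← sq_abs]
  gcongr
  rw [softThreshold]
  rcases le_total g ℓ with h | h
  · rw [min_eq_left h]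
    rcases le_total (-ℓ) g with h' | h'
    · rw [max_eq_right h']
      simp
    · rw [max_eq_left h', abs_of_nonpos (by linarith), abs_of_nonpos (by linarith)]
      exact le_max_of_le_left (by linarith)
  · rw [min_eq_right h, max_eq_right (by linarith), abs_of_nonneg (by linarith),
      abs_of_nonneg (by linarith)]
    exact le_max_left _ _

lemma lintegral_sq_gaussianReal (v : ℝ≥0) :
    ∫⁻ x, ENNReal.ofReal (x ^ 2) ∂(gaussianReal 0 v) = v := by
  have h1 : Integrable (fun x : ℝ => x ^ 2) (gaussianReal 0 v) :=
    (memLp_id_gaussianReal 2).integrable_sq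
  rw [← ofReal_integral_eq_lintegral_ofReal h1 (Eventually.of_forall fun x => sq_nonneg x)]
  have h2 := variance_id_gaussianReal (μ := 0) (v := v)
  rw [variance_of_integral_eq_zero measurable_id.aemeasurable (by simp [integral_id_gaussianReal])] at h2
  simp only [id] at h2
  rw [h2]
  simp

lemma lintegral_exp_mul_gaussianReal (v : ℝ≥0) (t : ℝ) :
    ∫⁻ x, ENNReal.ofReal (Real.exp (t * x)) ∂(gaussianReal 0 v) =
      ENNReal.ofReal (Real.exp (v * t ^ 2 / 2)) := by
  rw [← ofReal_integral_eq_lintegral_ofReal (integrable_exp_mul_gaussianReal t)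
    (Eventually.of_forall fun x => (Real.exp_pos _).le)]
  have h := congrFun (mgf_id_gaussianReal (μ := 0) (v := v)) t
  rw [mgf] at h
  simp only [id, zero_mul, zero_add] at h
  rw [h]

lemma lintegral_abs_add_sq_gaussianReal_le (v : ℝ≥0) (lam ε : ℝ) (hε : 0 < ε) :
    ∫⁻ g, ENNReal.ofReal ((|g| + lam) ^ 2) ∂(gaussianReal 0 v) ≤
      ENNReal.ofReal ((1 + ε) * lam ^ 2 + (1 + 1 / ε) * v) := by
  have h : ∀ g : ℝ, ENNReal.ofReal ((|g| + lam) ^ 2) ≤ ENNReal.ofReal ((1 + ε) * lam ^ 2) +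
      ENNReal.ofReal (1 + 1 / ε) * ENNReal.ofReal (g ^ 2) := by
    intro g
    rw [← ENNReal.ofReal_mul (by positivity), ← ENNReal.ofReal_add (by positivity) (by positivity)]
    refine ENNReal.ofReal_le_ofReal ?_
    have h1 : 0 ≤ (|g| - ε * lam) ^ 2 / ε := by positivity
    have h2 : (1 + ε) * lam ^ 2 + (1 + 1 / ε) * g ^ 2 =
        (|g| + lam) ^ 2 + (|g| - ε * lam) ^ 2 / ε := by
      rw [← sq_abs g]
      field_simp
      ring
    linarith
  refine (lintegral_mono h).trans (le_of_eq ?_)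
  rw [lintegral_add_left measurable_const, lintegral_const_mul _ (by fun_prop),
    lintegral_sq_gaussianReal, lintegral_const, measure_univ, mul_one,
    ENNReal.ofReal_add (p := (1 + ε) * lam ^ 2) (by positivity) (by positivity),
    ENNReal.ofReal_mul (p := 1 + 1 / ε) (by positivity), ENNReal.ofReal_coe_nnreal]

lemma lintegral_excess_sq_gaussianReal_le (v : ℝ≥0) (lam α : ℝ) (hα : 0 < α) :
    ∫⁻ g, ENNReal.ofReal (max (|g| - lam) 0 ^ 2) ∂(gaussianReal 0 v) ≤
      ENNReal.ofReal (4 / α ^ 2 * Real.exp (v * α ^ 2 / 2 - α * lam)) := by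
  have h : ∀ g : ℝ, ENNReal.ofReal (max (|g| - lam) 0 ^ 2) ≤
      ENNReal.ofReal (2 / α ^ 2 * Real.exp (-(α * lam))) *
        (ENNReal.ofReal (Real.exp (α * g)) + ENNReal.ofReal (Real.exp (-α * g))) := by
    intro g
    rw [← ENNReal.ofReal_add (by positivity) (by positivity), ← ENNReal.ofReal_mul (by positivity)]
    refine ENNReal.ofReal_le_ofReal ?_
    have h1 : max (|g| - lam) 0 ^ 2 ≤ 2 / α ^ 2 * Real.exp (α * (|g| - lam)) := by
      rcases le_total (|g| - lam) 0 with h0 | h0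
      · rw [max_eq_right h0]
        simp only [ne_eq, OfNat.ofNat_ne_zero, not_false_eq_true, zero_pow]
        positivity
      · rw [max_eq_left h0, div_mul_eq_mul_div, le_div_iff₀ (by positivity)]
        have := Real.quadratic_le_exp_of_nonneg (mul_nonneg hα.le h0)
        nlinarith [mul_nonneg hα.le h0]
    refine h1.trans ?_
    rw [mul_assoc, mul_add, ← Real.exp_add, ← Real.exp_add]
    refine mul_le_mul_of_nonneg_left ?_ (by positivity)
    rcases abs_cases g with ⟨h2, -⟩ | ⟨h2, -⟩
    · rw [h2, show α * (g - lam) = -(α * lam) + α * g by ring]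
      linarith [Real.exp_pos (-(α * lam) + -α * g)]
    · rw [h2, show α * (-g - lam) = -(α * lam) + -α * g by ring]
      linarith [Real.exp_pos (-(α * lam) + α * g)]
  refine (lintegral_mono h).trans (le_of_eq ?_)
  rw [lintegral_const_mul _ (by fun_prop), lintegral_add_left (by fun_prop),
    lintegral_exp_mul_gaussianReal, lintegral_exp_mul_gaussianReal, neg_sq,
    ← ENNReal.ofReal_add (by positivity) (by positivity), ← ENNReal.ofReal_mul (by positivity)]
  congr 1
  rw [sub_eq_add_neg, Real.exp_add]
  ring

/-- Soft-thresholded least squares for the scalar regression of `y` on `x`. -/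
def coordEst {ι : Type*} [Fintype ι] (lam : ℝ) (x y : ι → ℝ) : ℝ :=
  softThreshold ((∑ i, x i * y i) / ∑ i, x i ^ 2) (lam / Real.sqrt (∑ i, x i ^ 2))

lemma measurable_coordEst {ι : Type*} [Fintype ι] (lam : ℝ) :
    Measurable fun u : (ι → ℝ) × (ι → ℝ) => coordEst lam u.1 u.2 := by
  unfold coordEst softThreshold
  fun_prop

lemma coordEst_risk_le {ι : Type*} [Fintype ι] (v s : ℝ≥0) (hv : v ≠ 0) (hι : 2 < Fintype.card ι)
    (lam θ : ℝ) (H : ℝ → ℝ) (hHm : Measurable H)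
    (hH : ∀ N g : ℝ, 0 < N →
      (softThreshold (θ + g) (lam / Real.sqrt N) - θ) ^ 2 ≤ 1 / N * H (Real.sqrt N * g)) :
    ∫⁻ x, ∫⁻ w, ENNReal.ofReal ((coordEst lam x (fun i => x i * θ + w i) - θ) ^ 2)
      ∂(Measure.pi fun _ : ι => gaussianReal 0 s) ∂(Measure.pi fun _ : ι => gaussianReal 0 v) ≤
      ENNReal.ofReal (1 / (v * (Fintype.card ι - 2))) *
        ∫⁻ g, ENNReal.ofReal (H g) ∂(gaussianReal 0 s) := by
  have hne : Nonempty ι := Fintype.card_pos_iff.1 (by omega)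
  have hae : ∀ᵐ x ∂(Measure.pi fun _ : ι => gaussianReal 0 v), 0 < ∑ i, x i ^ 2 := by
    have hna : NullSingletonClass (gaussianReal 0 v) := nullSingletonClass_gaussianReal hv
    have h1 : (Measure.pi fun _ : ι => gaussianReal 0 v) {0} = 0 := by
      obtain ⟨i⟩ := hne
      have := Measure.pi_nullSingletonClass (μ := fun _ : ι => gaussianReal 0 v) i
      exact measure_singleton _
    have h2 : ∀ᵐ x ∂(Measure.pi fun _ : ι => gaussianReal 0 v), x ≠ 0 := by
      simp [ae_iff, h1]
    filter_upwards [h2] with x hx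
    obtain ⟨i, hi⟩ := Function.ne_iff.1 hx
    have hi' : x i ≠ 0 := hi
    exact lt_of_lt_of_le (by positivity) (Finset.single_le_sum (f := fun i => x i ^ 2)
      (fun _ _ => sq_nonneg _) (Finset.mem_univ i))
  have hinner : ∀ x : ι → ℝ, 0 < ∑ i, x i ^ 2 →
      ∫⁻ w, ENNReal.ofReal ((coordEst lam x (fun i => x i * θ + w i) - θ) ^ 2)
        ∂(Measure.pi fun _ : ι => gaussianReal 0 s) ≤
      ENNReal.ofReal (1 / ∑ i, x i ^ 2) * ∫⁻ g, ENNReal.ofReal (H g) ∂(gaussianReal 0 s) := by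
    intro x hx
    set N := ∑ i, x i ^ 2 with hN
    have hsq : Real.sqrt N * Real.sqrt N = N := Real.mul_self_sqrt hx.le
    have hsN : 0 < Real.sqrt N := Real.sqrt_pos.2 hx
    have hlaw : (Measure.pi fun _ : ι => gaussianReal 0 s).map (fun w => ∑ i, x i / Real.sqrt N * w i)
        = gaussianReal 0 s := by
      rw [map_linear_pi_gaussianReal]
      congr 1
      simp only [div_pow, Real.sq_sqrt hx.le]
      rw [← Finset.sum_mul, ← Finset.sum_div, div_self hx.ne', one_mul, Real.toNNReal_coe]
    have hH' : ∫⁻ g, ENNReal.ofReal (H g) ∂(gaussianReal 0 s) =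
        ∫⁻ w, ENNReal.ofReal (H (∑ i, x i / Real.sqrt N * w i))
          ∂(Measure.pi fun _ : ι => gaussianReal 0 s) := by
      conv_lhs => rw [← hlaw]
      rw [lintegral_map (by fun_prop) (by fun_prop)]
    rw [hH', ← lintegral_const_mul _ (by fun_prop)]
    refine lintegral_mono fun w => ?_
    rw [← ENNReal.ofReal_mul (by positivity)]
    refine ENNReal.ofReal_le_ofReal ?_
    have h1 : (∑ i, x i * (x i * θ + w i)) / N = θ + (∑ i, x i * w i) / N := by
      have hsum : ∑ i, x i * (x i * θ + w i) = N * θ + ∑ i, x i * w i := by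
        rw [hN, Finset.sum_mul, ← Finset.sum_add_distrib]
        exact Finset.sum_congr rfl fun i _ => by ring
      rw [hsum, add_div, mul_div_cancel_left₀ _ hx.ne']
    have h2 : ∑ i, x i / Real.sqrt N * w i = Real.sqrt N * ((∑ i, x i * w i) / N) := by
      nth_rewrite 3 [← hsq]
      simp_rw [div_mul_eq_mul_div]
      rw [← Finset.sum_div]
      field_simp
    rw [coordEst, ← hN, h1, h2]
    exact hH N _ hx
  refine (lintegral_mono_ae (hae.mono hinner)).trans ?_
  rw [lintegral_mul_const _ (by fun_prop)]
  gcongr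
  exact lintegral_inv_sum_sq_pi_le v (pos_iff_ne_zero.2 hv) hι

/-- Coordinatewise thresholded estimator after removing the other coordinates of a pilot `b`. -/
def thresholdEst {ι : Type*} [Fintype ι] {p : ℕ} (lam : ℝ) (b : Fin p → ℝ)
    (B : ι → (Fin p → ℝ) × ℝ) (j : Fin p) : ℝ :=
  coordEst lam (fun i => (B i).1 j) (fun i => (B i).2 - ∑ l, (B i).1 l * if l = j then 0 else b l)

lemma measurable_thresholdEst {ι : Type*} [Fintype ι] {p : ℕ} (lam : ℝ) :
    Measurable fun u : (Fin p → ℝ) × (ι → (Fin p → ℝ) × ℝ) => thresholdEst lam u.1 u.2 := by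
  refine measurable_pi_lambda _ fun j => ?_
  refine (measurable_coordEst lam).comp (Measurable.prodMk (by fun_prop) ?_)
  refine measurable_pi_lambda _ fun i => Measurable.sub (by fun_prop) ?_
  refine Finset.measurable_sum _ fun l _ => Measurable.mul (by fun_prop) ?_
  split_ifs <;> fun_prop

lemma coordEst_prod_risk_le {ι : Type*} [Fintype ι] (v s : ℝ≥0) (hv : v ≠ 0)
    (hι : 2 < Fintype.card ι) (lam θ : ℝ) (H : ℝ → ℝ)
    (hHm : Measurable H) (hH : ∀ N g : ℝ, 0 < N →
      (softThreshold (θ + g) (lam / Real.sqrt N) - θ) ^ 2 ≤ 1 / N * H (Real.sqrt N * g)) :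
    ∫⁻ a, ENNReal.ofReal
      ((coordEst lam (fun i => (a i).1) (fun i => (a i).1 * θ + (a i).2) - θ) ^ 2)
      ∂(Measure.pi fun _ : ι => (gaussianReal 0 v).prod (gaussianReal 0 s)) ≤
      ENNReal.ofReal (1 / (v * (Fintype.card ι - 2))) *
        ∫⁻ g, ENNReal.ofReal (H g) ∂(gaussianReal 0 s) := by
  have hFm : Measurable fun u : (ι → ℝ) × (ι → ℝ) =>
      ENNReal.ofReal ((coordEst lam u.1 (fun i => u.1 i * θ + u.2 i) - θ) ^ 2) := by
    have : Measurable fun u : (ι → ℝ) × (ι → ℝ) => coordEst lam u.1 (fun i => u.1 i * θ + u.2 i) :=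
      (measurable_coordEst lam).comp
        (g := fun u : (ι → ℝ) × (ι → ℝ) => coordEst lam u.1 u.2)
        (f := fun u : (ι → ℝ) × (ι → ℝ) => (u.1, fun i => u.1 i * θ + u.2 i)) (by fun_prop)
    fun_prop
  have hmp := measurePreserving_arrowProdEquivProdArrow ℝ ℝ ι
    (fun _ => gaussianReal 0 v) (fun _ => gaussianReal 0 s)
  have h1 := hmp.lintegral_comp hFm
  rw [lintegral_prod _ hFm.aemeasurable] at h1
  exact h1.trans_le (coordEst_risk_le (ι := ι) v s hv hι lam θ H hHm hH)

lemma thresholdEst_rowData {ι : Type*} [Fintype ι] {p : ℕ} (lam σ : ℝ) (β b : Fin p → ℝ)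
    (j : Fin p) (B : ι → (Fin p → ℝ) × ℝ) :
    thresholdEst lam b (fun i => rowData σ β (B i)) j =
      coordEst lam (fun i => (B i).1 j) (fun i => (B i).1 j * β j +
        (∑ l, (if l = j then 0 else β l - b l) * (B i).1 l + σ * (B i).2)) := by
  unfold thresholdEst
  congr 1
  ext i
  simp only [rowData]
  have : ∀ l, (B i).1 l * β l - (B i).1 l * (if l = j then 0 else b l) =
      (if l = j then 0 else β l - b l) * (B i).1 l + if l = j then (B i).1 l * β l else 0 := by
    intro l
    split_ifs <;> ring
  rw [add_sub_right_comm, ← Finset.sum_sub_distrib, Finset.sum_congr rfl fun l _ => this l,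
    Finset.sum_add_distrib, Finset.sum_ite_eq' Finset.univ j, if_pos (Finset.mem_univ j)]
  ring

lemma thresholdEst_coord_risk_le {ι : Type*} [Fintype ι] (n p : ℕ) (hn : 0 < n)
    (hι : 2 < Fintype.card ι) (lam σ : ℝ) (β b : Fin p → ℝ) (j : Fin p) (H : ℝ → ℝ)
    (hHm : Measurable H) (hH : ∀ N g : ℝ, 0 < N →
      (softThreshold (β j + g) (lam / Real.sqrt N) - β j) ^ 2 ≤ 1 / N * H (Real.sqrt N * g)) :
    ∫⁻ B, ENNReal.ofReal ((thresholdEst lam b (fun i => rowData σ β (B i)) j - β j) ^ 2)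
      ∂(Measure.pi fun _ : ι => rowLaw n p) ≤
      ENNReal.ofReal (n / (Fintype.card ι - 2)) * ∫⁻ g, ENNReal.ofReal (H g)
        ∂(gaussianReal 0 (Real.toNNReal
          ((∑ l, (if l = j then 0 else β l - b l) ^ 2) / n + σ ^ 2))) := by
  set c : Fin p → ℝ := fun l => if l = j then 0 else β l - b l with hc
  have hcj : c j = 0 := by simp [hc]
  set s := Real.toNNReal ((∑ l, c l ^ 2) / n + σ ^ 2) with hs
  set φ : (Fin p → ℝ) × ℝ → ℝ × ℝ := fun w => (w.1 j, ∑ l, c l * w.1 l + σ * w.2) with hφ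
  have hφm : Measurable φ := by fun_prop
  have hmap : (Measure.pi fun _ : ι => rowLaw n p).map (fun B i => φ (B i)) =
      Measure.pi fun _ : ι => (gaussianReal 0 (n : ℝ≥0)⁻¹).prod (gaussianReal 0 s) := by
    have hrow := rowLaw_map_coord_linear n p j c hcj σ
    have := Measure.pi_map_pi (μ := fun _ : ι => rowLaw n p) (f := fun _ => φ)
      (hμ := fun _ => by rw [hrow]; infer_instance) (fun _ => hφm.aemeasurable)
    rw [this, hrow]
  have h2 := coordEst_prod_risk_le (ι := ι) (n : ℝ≥0)⁻¹ s (by positivity) hι lam (β j) H hHm hH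
  have hGm : Measurable fun a : ι → ℝ × ℝ => ENNReal.ofReal
      ((coordEst lam (fun i => (a i).1) (fun i => (a i).1 * β j + (a i).2) - β j) ^ 2) := by
    have : Measurable fun a : ι → ℝ × ℝ =>
        coordEst lam (fun i => (a i).1) (fun i => (a i).1 * β j + (a i).2) :=
      (measurable_coordEst lam).comp
        (g := fun u : (ι → ℝ) × (ι → ℝ) => coordEst lam u.1 u.2)
        (f := fun a : ι → ℝ × ℝ => (fun i => (a i).1, fun i => (a i).1 * β j + (a i).2))
        (by fun_prop)
    fun_prop
  rw [← hmap, lintegral_map hGm (by fun_prop)] at h2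
  have hcoef : (1 / (((n : ℝ≥0)⁻¹ : ℝ≥0) * ((Fintype.card ι : ℝ) - 2)) : ℝ) =
      n / (Fintype.card ι - 2) := by
    push_cast
    rw [one_div, mul_inv, inv_inv, div_eq_mul_inv]
  rw [hcoef] at h2
  refine le_trans (le_of_eq (lintegral_congr fun B => ?_)) h2
  rw [thresholdEst_rowData]

lemma coe_toNNReal_variance_le {p : ℕ} (n : ℕ) (σ : ℝ) (β b : Fin p → ℝ) (j : Fin p) (S : ℝ)
    (hS : (∑ l, (β l - b l) ^ 2) / n + σ ^ 2 ≤ S) :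
    ((Real.toNNReal ((∑ l, (if l = j then 0 else β l - b l) ^ 2) / n + σ ^ 2) : ℝ≥0) : ℝ) ≤ S := by
  rw [Real.coe_toNNReal _ (by positivity)]
  refine le_trans ?_ hS
  have : ∀ l, (if l = j then 0 else β l - b l) ^ 2 ≤ (β l - b l) ^ 2 := fun l => by
    split_ifs
    · simp [sq_nonneg]
    · exact le_rfl
  exact add_le_add_left (div_le_div_of_nonneg_right (Finset.sum_le_sum fun l _ => this l)
    (Nat.cast_nonneg n)) _

lemma thresholdEst_coord_risk_le_general {ι : Type*} [Fintype ι] (n p : ℕ) (hn : 0 < n)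
    (hι : 2 < Fintype.card ι) (lam σ : ℝ) (hlam : 0 ≤ lam) (β b : Fin p → ℝ) (j : Fin p)
    (ε : ℝ) (hε : 0 < ε) (S : ℝ) (hS : (∑ l, (β l - b l) ^ 2) / n + σ ^ 2 ≤ S) :
    ∫⁻ B, ENNReal.ofReal ((thresholdEst lam b (fun i => rowData σ β (B i)) j - β j) ^ 2)
      ∂(Measure.pi fun _ : ι => rowLaw n p) ≤
      ENNReal.ofReal (n / (Fintype.card ι - 2) * ((1 + ε) * lam ^ 2 + (1 + 1 / ε) * S)) := by
  have hι' : (0 : ℝ) < (Fintype.card ι : ℝ) - 2 := by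
    have : (2 : ℝ) < Fintype.card ι := by exact_mod_cast hι
    linarith
  have hS0 : 0 ≤ S := le_trans (by positivity) hS
  refine (thresholdEst_coord_risk_le n p hn hι lam σ β b j (fun g => (|g| + lam) ^ 2)
    (by fun_prop) fun N g hN => ?_).trans ?_
  · have hs : 0 < Real.sqrt N := Real.sqrt_pos.2 hN
    refine (softThreshold_sub_sq_le _ _ _ (by positivity)).trans (le_of_eq ?_)
    rw [abs_mul, abs_of_pos hs]
    nth_rewrite 2 [← Real.sq_sqrt hN.le]
    field_simp
  · rw [ENNReal.ofReal_mul (by positivity)]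
    gcongr
    refine (lintegral_abs_add_sq_gaussianReal_le _ lam ε hε).trans (ENNReal.ofReal_le_ofReal ?_)
    gcongr
    exact coe_toNNReal_variance_le n σ β b j S hS

lemma thresholdEst_coord_risk_le_zero {ι : Type*} [Fintype ι] (n p : ℕ) (hn : 0 < n)
    (hι : 2 < Fintype.card ι) (lam σ : ℝ) (hlam : 0 ≤ lam) (β b : Fin p → ℝ) (j : Fin p)
    (hj : β j = 0) (α : ℝ) (hα : 0 < α) (S : ℝ)
    (hS : (∑ l, (β l - b l) ^ 2) / n + σ ^ 2 ≤ S) :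
    ∫⁻ B, ENNReal.ofReal ((thresholdEst lam b (fun i => rowData σ β (B i)) j - β j) ^ 2)
      ∂(Measure.pi fun _ : ι => rowLaw n p) ≤
      ENNReal.ofReal (n / (Fintype.card ι - 2) *
        (4 / α ^ 2 * Real.exp (S * α ^ 2 / 2 - α * lam))) := by
  have hι' : (0 : ℝ) < (Fintype.card ι : ℝ) - 2 := by
    have : (2 : ℝ) < Fintype.card ι := by exact_mod_cast hι
    linarith
  refine (thresholdEst_coord_risk_le n p hn hι lam σ β b j (fun g => max (|g| - lam) 0 ^ 2)
    (by fun_prop) fun N g hN => ?_).trans ?_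
  · have hs : 0 < Real.sqrt N := Real.sqrt_pos.2 hN
    rw [hj, zero_add, sub_zero]
    refine (softThreshold_sq_le _ _ (by positivity)).trans (le_of_eq ?_)
    have h1 : max (|Real.sqrt N * g| - lam) 0 = Real.sqrt N * max (|g| - lam / Real.sqrt N) 0 := by
      rw [mul_max_of_nonneg _ _ hs.le, abs_mul, abs_of_pos hs, mul_zero, mul_sub,
        mul_div_cancel₀ _ hs.ne']
    rw [h1, mul_pow, Real.sq_sqrt hN.le, ← mul_assoc, one_div_mul_cancel hN.ne', one_mul]
  · rw [ENNReal.ofReal_mul (by positivity)]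
    gcongr
    refine (lintegral_excess_sq_gaussianReal_le _ lam α hα).trans (ENNReal.ofReal_le_ofReal ?_)
    gcongr
    exact coe_toNNReal_variance_le n σ β b j S hS

lemma thresholdEst_loss_le {ι : Type*} [Fintype ι] (n p : ℕ) (lam σ : ℝ) (β b : Fin p → ℝ)
    (C : Fin p → ℝ) (hC : ∀ j, 0 ≤ C j)
    (h : ∀ j, ∫⁻ B, ENNReal.ofReal ((thresholdEst lam b (fun i => rowData σ β (B i)) j - β j) ^ 2)
      ∂(Measure.pi fun _ : ι => rowLaw n p) ≤ ENNReal.ofReal (C j)) :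
    ∫⁻ B, ENNReal.ofReal (∑ j, (thresholdEst lam b (fun i => rowData σ β (B i)) j - β j) ^ 2)
      ∂(Measure.pi fun _ : ι => rowLaw n p) ≤ ENNReal.ofReal (∑ j, C j) := by
  have hm : Measurable fun B : ι → (Fin p → ℝ) × ℝ =>
      thresholdEst lam b (fun i => rowData σ β (B i)) := by
    refine (measurable_thresholdEst lam).comp
      (f := fun B : ι → (Fin p → ℝ) × ℝ => (b, fun i => rowData σ β (B i))) ?_
    have := measurable_rowData σ β
    fun_prop
  rw [ENNReal.ofReal_sum_of_nonneg fun j _ => hC j]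
  simp_rw [ENNReal.ofReal_sum_of_nonneg fun j _ => sq_nonneg _]
  rw [lintegral_finsetSum _ fun j _ => by fun_prop]
  exact Finset.sum_le_sum fun j _ => h j

lemma thresholdEst_loss_le_general {ι : Type*} [Fintype ι] (n p : ℕ) (hn : 0 < n)
    (hι : 2 < Fintype.card ι) (lam σ : ℝ) (hlam : 0 ≤ lam) (β b : Fin p → ℝ)
    (S : ℝ) (hS : (∑ l, (β l - b l) ^ 2) / n + σ ^ 2 ≤ S) :
    ∫⁻ B, ENNReal.ofReal (∑ j, (thresholdEst lam b (fun i => rowData σ β (B i)) j - β j) ^ 2)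
      ∂(Measure.pi fun _ : ι => rowLaw n p) ≤
      ENNReal.ofReal (n / (Fintype.card ι - 2) * (p * (2 * lam ^ 2 + 2 * S))) := by
  have hι' : (0 : ℝ) < (Fintype.card ι : ℝ) - 2 := by
    have : (2 : ℝ) < Fintype.card ι := by exact_mod_cast hι
    linarith
  have hS0 : 0 ≤ S := le_trans (by positivity) hS
  refine (thresholdEst_loss_le n p lam σ β b (fun _ => n / (Fintype.card ι - 2) *
    ((1 + 1) * lam ^ 2 + (1 + 1 / 1) * S)) (fun j => by positivity) fun j =>
    thresholdEst_coord_risk_le_general n p hn hι lam σ hlam β b j 1 one_pos S hS).trans_eq ?_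
  rw [Finset.sum_const, Finset.card_univ, Fintype.card_fin, nsmul_eq_mul]
  congr 1
  ring

lemma thresholdEst_loss_le_sparse {ι : Type*} [Fintype ι] (n p k : ℕ) (hn : 0 < n)
    (hι : 2 < Fintype.card ι) (lam σ : ℝ) (hlam : 0 ≤ lam) (β b : Fin p → ℝ) (hβ : l0norm β ≤ k)
    (ε : ℝ) (hε : 0 < ε) (α : ℝ) (hα : 0 < α)
    (S : ℝ) (hS : (∑ l, (β l - b l) ^ 2) / n + σ ^ 2 ≤ S) :
    ∫⁻ B, ENNReal.ofReal (∑ j, (thresholdEst lam b (fun i => rowData σ β (B i)) j - β j) ^ 2)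
      ∂(Measure.pi fun _ : ι => rowLaw n p) ≤
      ENNReal.ofReal (n / (Fintype.card ι - 2) * (k * ((1 + ε) * lam ^ 2 + (1 + 1 / ε) * S) +
        p * (4 / α ^ 2 * Real.exp (S * α ^ 2 / 2 - α * lam)))) := by
  have hι' : (0 : ℝ) < (Fintype.card ι : ℝ) - 2 := by
    have : (2 : ℝ) < Fintype.card ι := by exact_mod_cast hι
    linarith
  have hS0 : 0 ≤ S := le_trans (by positivity) hS
  set D₁ := (1 + ε) * lam ^ 2 + (1 + 1 / ε) * S with hD₁
  set D₂ := 4 / α ^ 2 * Real.exp (S * α ^ 2 / 2 - α * lam) with hD₂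
  have hD₁0 : 0 ≤ D₁ := by positivity
  have hD₂0 : 0 ≤ D₂ := by positivity
  set F : ℝ := n / (Fintype.card ι - 2) with hF
  have hF0 : 0 ≤ F := by positivity
  refine (thresholdEst_loss_le n p lam σ β b (fun j => F * ((if β j ≠ 0 then D₁ else 0) + D₂))
    (fun j => by split_ifs <;> positivity) fun j => ?_).trans (ENNReal.ofReal_le_ofReal ?_)
  · by_cases hj : β j = 0
    · rw [if_neg (not_not.2 hj), zero_add]
      exact thresholdEst_coord_risk_le_zero n p hn hι lam σ hlam β b j hj α hα S hS
    · rw [if_pos hj]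
      refine (thresholdEst_coord_risk_le_general n p hn hι lam σ hlam β b j ε hε S hS).trans
        (ENNReal.ofReal_le_ofReal ?_)
      exact mul_le_mul_of_nonneg_left (le_add_of_nonneg_right hD₂0) hF0
  · rw [← Finset.mul_sum, Finset.sum_add_distrib, ← Finset.sum_filter, Finset.sum_const,
      Finset.sum_const, Finset.card_univ, Fintype.card_fin, nsmul_eq_mul, nsmul_eq_mul]
    have : ((Finset.univ.filter fun j => β j ≠ 0).card : ℝ) ≤ k := by exact_mod_cast hβ
    gcongr

lemma exists_twoStage_est (n p : ℕ) (P : Fin n → Prop) [DecidablePred P] (lam : ℝ)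
    (G : Finset (Fin p → ℝ)) (hG : G.Nonempty) :
    ∃ est : (Fin n → Fin p → ℝ) × (Fin n → ℝ) → Fin p → ℝ, Measurable est ∧
      ∀ (σ : ℝ) (β : Fin p → ℝ), ∃ E : (Fin p → ℝ) → Set ({i // P i} → (Fin p → ℝ) × ℝ),
        ∑ b ∈ G, (Measure.pi fun _ : {i // P i} => rowLaw n p) (E b) ≤ 1 ∧
        (∀ b ∈ G, ∀ A ∈ E b, ∀ b' ∈ G, sumSqResid b (fun i => rowData σ β (A i)) ≤
          sumSqResid b' (fun i => rowData σ β (A i))) ∧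
        risk n p σ est β ≤ ∑ b ∈ G, (Measure.pi fun _ : {i // P i} => rowLaw n p) (E b) *
          ∫⁻ B, ENNReal.ofReal (∑ j, (thresholdEst lam b (fun i => rowData σ β (B i)) j - β j) ^ 2)
            ∂(Measure.pi fun _ : {i // ¬ P i} => rowLaw n p) := by
  obtain ⟨sel, hselm, hsel⟩ := exists_measurable_argmin G hG
    (fun (b : Fin p → ℝ) (A : {i // P i} → (Fin p → ℝ) × ℝ) => sumSqResid b A)
    (fun b => measurable_sumSqResid b)
  have hTm : Measurable fun u : ({i // P i} → (Fin p → ℝ) × ℝ) × ({i // ¬ P i} → (Fin p → ℝ) × ℝ) =>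
      thresholdEst lam (sel u.1) u.2 :=
    (measurable_thresholdEst lam).comp (f := fun u : ({i // P i} → (Fin p → ℝ) × ℝ) ×
      ({i // ¬ P i} → (Fin p → ℝ) × ℝ) => (sel u.1, u.2)) (by fun_prop)
  refine ⟨fun ω => thresholdEst lam (sel fun i : {i // P i} => (ω.1 i, ω.2 i))
    (fun i : {i // ¬ P i} => (ω.1 i, ω.2 i)), ?_, fun σ β => ?_⟩
  · exact hTm.comp (f := fun ω : (Fin n → Fin p → ℝ) × (Fin n → ℝ) =>
      ((fun i : {i // P i} => (ω.1 i, ω.2 i)), fun i : {i // ¬ P i} => (ω.1 i, ω.2 i)))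
      (by fun_prop)
  have hrm := measurable_rowData σ β
  have hsm : Measurable fun A : {i // P i} → (Fin p → ℝ) × ℝ =>
      sel fun i => rowData σ β (A i) := hselm.comp (by fun_prop)
  have hfm : Measurable (Function.uncurry fun (A : {i // P i} → (Fin p → ℝ) × ℝ)
      (B : {i // ¬ P i} → (Fin p → ℝ) × ℝ) => ENNReal.ofReal (∑ j,
        (thresholdEst lam (sel fun i => rowData σ β (A i)) (fun i => rowData σ β (B i)) j
          - β j) ^ 2)) := by
    have : Measurable fun u : ({i // P i} → (Fin p → ℝ) × ℝ) × ({i // ¬ P i} → (Fin p → ℝ) × ℝ) =>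
        thresholdEst lam (sel fun i => rowData σ β (u.1 i)) (fun i => rowData σ β (u.2 i)) :=
      hTm.comp (f := fun u : ({i // P i} → (Fin p → ℝ) × ℝ) ×
        ({i // ¬ P i} → (Fin p → ℝ) × ℝ) =>
        ((fun i => rowData σ β (u.1 i)), fun i => rowData σ β (u.2 i))) (by fun_prop)
    unfold Function.uncurry
    fun_prop
  have hEm : ∀ b : Fin p → ℝ, MeasurableSet
      {A : {i // P i} → (Fin p → ℝ) × ℝ | (sel fun i => rowData σ β (A i)) = b} :=
    fun b => hsm (measurableSet_singleton b)
  refine ⟨fun b => {A | (sel fun i => rowData σ β (A i)) = b}, ?_, ?_, ?_⟩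
  · have := sum_measure_preimage_singleton (μ := Measure.pi fun _ : {i // P i} => rowLaw n p) G
      (f := fun A => sel fun i => rowData σ β (A i)) (fun b _ => hEm b)
    exact this.trans_le prob_le_one
  · rintro b - A rfl b' hb'
    exact (hsel _).2 b' hb'
  · have h1 := lintegral_model_eq_rows n p P _ hfm
    refine le_trans (le_of_eq (Eq.trans (lintegral_congr fun ω => ?_) h1)) ?_
    · rfl
    simp_rw [mul_comm (Measure.pi _ _), ← lintegral_indicator_const (hEm _)]
    rw [← lintegral_finsetSum _ fun b _ => measurable_const.indicator (hEm b)]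
    refine lintegral_mono fun A => ?_
    refine le_trans (le_of_eq ?_) (Finset.single_le_sum (fun _ _ => zero_le)
      (hsel fun i => rowData σ β (A i)).1)
    rw [Set.indicator_of_mem (by rfl)]

lemma round_mem_sparseGrid (p k : ℕ) (h τ : ℝ) (hh : 0 < h) (hτ : 0 ≤ τ) (β : Fin p → ℝ)
    (hβ : β ∈ Theta p k τ) :
    (fun j => round (β j / h)) ∈ sparseGrid p k
      (Finset.Icc (-⌈τ * Real.sqrt k / h + 1⌉) ⌈τ * Real.sqrt k / h + 1⌉) := by
  obtain ⟨h0, h2⟩ := hβ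
  rw [sparseGrid, Finset.mem_filter, Fintype.mem_piFinset]
  constructor
  · intro j
    have h3 : β j ^ 2 ≤ k * τ ^ 2 :=
      (Finset.single_le_sum (f := fun j => β j ^ 2) (fun _ _ => sq_nonneg _)
        (Finset.mem_univ j)).trans h2
    have h4 : |β j| ≤ τ * Real.sqrt k := by
      refine abs_le_of_sq_le_sq (h3.trans_eq ?_) (by positivity)
      rw [mul_pow, Real.sq_sqrt (Nat.cast_nonneg k)]
      ring
    have h5 : |β j / h| ≤ τ * Real.sqrt k / h := by
      rw [abs_div, abs_of_pos hh]
      gcongr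
    have h6 := abs_le.1 (abs_sub_round (β j / h))
    have h7 := abs_le.1 h5
    have h8 := Int.le_ceil (τ * Real.sqrt k / h + 1)
    rw [Finset.mem_Icc]
    constructor
    · have : ((-⌈τ * Real.sqrt k / h + 1⌉ : ℤ) : ℝ) ≤ round (β j / h) := by
        push_cast
        linarith
      exact_mod_cast this
    · have : (round (β j / h) : ℝ) ≤ (⌈τ * Real.sqrt k / h + 1⌉ : ℤ) := by linarith
      exact_mod_cast this
  · refine le_trans (Finset.card_le_card fun j hj => ?_) h0
    simp only [Finset.mem_filter, Finset.mem_univ, true_and] at hj ⊢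
    rintro hj0
    simp [hj0] at hj

lemma sum_sub_round_sq_le (p k : ℕ) (h : ℝ) (hh : 0 < h) (β : Fin p → ℝ) (hβ : l0norm β ≤ k) :
    ∑ j, (β j - h * round (β j / h)) ^ 2 ≤ k * h ^ 2 / 4 := by
  have h1 : ∀ j, (β j - h * round (β j / h)) ^ 2 ≤ if β j ≠ 0 then h ^ 2 / 4 else 0 := by
    intro j
    split_ifs with hj
    · have h2 := abs_sub_round (β j / h)
      have h3 : β j - h * round (β j / h) = h * (β j / h - round (β j / h)) := by
        field_simp
      rw [h3, mul_pow, ← sq_abs (_ - _)]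
      have h4 : |β j / h - round (β j / h)| ^ 2 ≤ (1 / 2) ^ 2 := by gcongr
      nlinarith [sq_nonneg h]
    · simp [not_not.1 hj]
  refine (Finset.sum_le_sum fun j _ => h1 j).trans ?_
  rw [← Finset.sum_filter, Finset.sum_const, nsmul_eq_mul, mul_div_assoc]
  have : ((Finset.univ.filter fun j => β j ≠ 0).card : ℝ) ≤ k := by exact_mod_cast hβ
  gcongr

/-- Failure probabilities of the least-squares pilot, weighted by the excess risk, are summable
over the lattice. -/
lemma sum_far_pilot_le {A₀ : ℝ} (hA : ∀ (κ t : ℝ) (S : Finset ℤ), 0 < κ → κ ≤ 1 →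
    ∑ v ∈ S, (1 + κ * (v - t) ^ 2)⁻¹ ≤ A₀ / κ) (p k M : ℕ) (hk : 0 < k) (hp : 0 < p)
    (hM : k + 1 ≤ M) (ε : ℝ) (hε : 0 < ε) (hε1 : ε ≤ 1 / 4) (S : Finset ℤ) (t : Fin p → ℝ)
    (r : (Fin p → ℤ) → ℝ) (hr : ∀ u, r u = ε / k * ∑ j, (u j - t j) ^ 2) :
    ∑ u ∈ (sparseGrid p k S).filter (fun u => 4 * ε < r u),
      (1 + r u) * ((1 + ε / 8 * r u)⁻¹) ^ M ≤
      8 / ε * ((1 + ε ^ 2 / 2)⁻¹) ^ (M - 1 - k) * ((p : ℝ) ^ k * Real.exp (8 * A₀ * k / ε ^ 2)) := by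
  have hk1 : (1 : ℝ) ≤ k := by exact_mod_cast hk
  have hκ : 0 < ε ^ 2 / (8 * k) := by positivity
  have hκ1 : ε ^ 2 / (8 * k) ≤ 1 := by
    rw [div_le_one (by positivity)]
    nlinarith
  have h1 := sum_sparseGrid_le hA p k hp S (ε ^ 2 / (8 * k)) hκ hκ1 t
  have h2 : A₀ / (ε ^ 2 / (8 * k)) = 8 * A₀ * k / ε ^ 2 := by
    field_simp
  rw [h2] at h1
  have hr0 : ∀ u, 0 ≤ r u := fun u => by rw [hr]; positivity
  refine le_trans ?_ (mul_le_mul_of_nonneg_left h1 (by positivity))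
  rw [Finset.mul_sum]
  refine (Finset.sum_le_sum fun u hu => ?_).trans (Finset.sum_le_sum_of_subset_of_nonneg
    (Finset.filter_subset _ _) fun u _ _ => ?_)
  · have hu' := (Finset.mem_filter.1 hu).2
    have h3 : ε ^ 2 / (8 * k) * ∑ j, (u j - t j) ^ 2 = ε / 8 * r u := by
      rw [hr]
      field_simp
    rw [h3]
    have hq : 0 < 1 + ε / 8 * r u := by have := hr0 u; positivity
    have h4 : ((1 + ε / 8 * r u)⁻¹) ^ M = (1 + ε / 8 * r u)⁻¹ * ((1 + ε / 8 * r u)⁻¹) ^ (M - 1 - k) *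
        ((1 + ε / 8 * r u)⁻¹) ^ k := by
      rw [← pow_succ', ← pow_add]
      congr 1
      omega
    have h5 : (1 + r u) * (1 + ε / 8 * r u)⁻¹ ≤ 8 / ε := by
      rw [← div_eq_mul_inv, div_le_div_iff₀ hq hε]
      nlinarith [hr0 u]
    have h6 : (1 + ε / 8 * r u)⁻¹ ≤ (1 + ε ^ 2 / 2)⁻¹ := by
      gcongr
      nlinarith
    calc (1 + r u) * ((1 + ε / 8 * r u)⁻¹) ^ M
        = ((1 + r u) * (1 + ε / 8 * r u)⁻¹) * ((1 + ε / 8 * r u)⁻¹) ^ (M - 1 - k) *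
          ((1 + ε / 8 * r u)⁻¹) ^ k := by rw [h4]; ring
      _ ≤ _ := by gcongr
  · positivity

lemma measure_far_selection_le {ι : Type*} [Fintype ι] (n p M : ℕ) (hn : 0 < n)
    (hι : Fintype.card ι = 4 * M) (σ ε : ℝ) (hσ : 0 < σ) (hε : 0 < ε) (hε1 : ε ≤ 1 / 4)
    (β b b₀ : Fin p → ℝ) (hb₀ : (∑ l, (β l - b₀ l) ^ 2) / (n * σ ^ 2) ≤ ε / 4)
    (hb : 4 * ε ≤ (∑ l, (β l - b l) ^ 2) / (n * σ ^ 2))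
    (E : Set (ι → (Fin p → ℝ) × ℝ))
    (hE : ∀ A ∈ E, sumSqResid b (fun i => rowData σ β (A i)) ≤
      sumSqResid b₀ (fun i => rowData σ β (A i))) :
    (Measure.pi fun _ : ι => rowLaw n p) E ≤ ENNReal.ofReal
      (((1 + ε / 8 * ((∑ l, (β l - b l) ^ 2) / (n * σ ^ 2)))⁻¹) ^ M) := by
  have hn' : (0 : ℝ) < n := by exact_mod_cast hn
  have hs : ∀ D : ℝ, 4 * (ε / (16 * σ ^ 2)) * (D / n + σ ^ 2) = ε / 4 * (1 + D / (n * σ ^ 2)) := by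
    intro D
    field_simp
    ring
  have h0 : 0 ≤ (∑ l, (β l - b₀ l) ^ 2) / (n * σ ^ 2) := by positivity
  have h1 := measure_selection_le n p M hι σ β b b₀ (ε / (16 * σ ^ 2)) (by positivity)
    (by rw [hs]; nlinarith) E hE
  rw [hs, hs] at h1
  refine h1.trans (ENNReal.ofReal_le_ofReal ?_)
  have h2 := selection_bracket_ge ε _ _ hε hε1 h0 hb₀ hb
  have h3 : 0 < 1 + ε / 8 * ((∑ l, (β l - b l) ^ 2) / (n * σ ^ 2)) := by positivity
  have h4 := inv_anti₀ h3 h2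
  have h5 := inv_nonneg.2 (h3.le.trans h2)
  gcongr

lemma minimaxRisk_le_explicit {A₀ : ℝ}
    (hA : ∀ (κ t : ℝ) (S : Finset ℤ), 0 < κ → κ ≤ 1 → ∑ v ∈ S, (1 + κ * (v - t) ^ 2)⁻¹ ≤ A₀ / κ)
    (n p k M : ℕ) (hk : 0 < k) (hkp : k < p) (hM : k + 1 ≤ M) (hMn : 4 * M + 2 < n)
    (τ σ ε : ℝ) (hτ : 0 < τ) (hσ : 0 < σ) (hε : 0 < ε) (hε1 : ε ≤ 1 / 4) :
    minimaxRisk n p k τ σ ≤ ENNReal.ofReal (n / (n - 4 * M - 2) *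
      (k * (σ ^ 2 * (1 + 4 * ε)) * (2 * (1 + ε) * Real.log ((p : ℝ) / k) + (1 + 1 / ε) +
        2 / Real.log ((p : ℝ) / k))) +
      n / (n - 4 * M - 2) * (p * (σ ^ 2 * (4 * (1 + 4 * ε) * Real.log ((p : ℝ) / k) + 2))) *
        (8 / ε * ((1 + ε ^ 2 / 2)⁻¹) ^ (M - 1 - k) *
          ((p : ℝ) ^ k * Real.exp (8 * A₀ * k / ε ^ 2)))) := by
  have hp : 0 < p := hk.trans hkp
  have hn : 0 < n := by omega
  have hk' : (0 : ℝ) < k := by exact_mod_cast hk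
  have hp' : (0 : ℝ) < p := by exact_mod_cast hp
  have hn' : (0 : ℝ) < n := by exact_mod_cast hn
  have hΛ : 0 < Real.log ((p : ℝ) / k) := Real.log_pos (by
    rw [lt_div_iff₀ hk', one_mul]
    exact_mod_cast hkp)
  have hexp : Real.exp (-Real.log ((p : ℝ) / k)) = k / p := by
    rw [Real.exp_neg, Real.exp_log (by positivity), inv_div]
  set Λ := Real.log ((p : ℝ) / k) with hΛdef
  have hF : (0 : ℝ) < n - 4 * M - 2 := by
    have : (4 * M + 2 : ℝ) < n := by exact_mod_cast hMn
    linarith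
  set V := σ ^ 2 * (1 + 4 * ε) with hV
  have hV0 : 0 < V := by positivity
  set lam := Real.sqrt (2 * Λ * V) with hlam
  have hlam0 : 0 < lam := Real.sqrt_pos.2 (by positivity)
  have hlam2 : lam ^ 2 = 2 * Λ * V := Real.sq_sqrt (by positivity)
  set h := σ * Real.sqrt (ε * n / k) with hh
  have hh0 : 0 < h := by positivity
  have hh2 : h ^ 2 = σ ^ 2 * (ε * n / k) := by
    rw [hh, mul_pow, Real.sq_sqrt (by positivity)]
  set S : Finset ℤ := Finset.Icc (-⌈τ * Real.sqrt k / h + 1⌉) ⌈τ * Real.sqrt k / h + 1⌉ with hS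
  set gr : (Fin p → ℤ) → Fin p → ℝ := fun u j => h * u j with hgr
  have hgrinj : Function.Injective gr := fun u v huv => by
    ext j
    have := congrFun huv j
    simp only [hgr] at this
    exact_mod_cast mul_left_cancel₀ hh0.ne' this
  set G := (sparseGrid p k S).image gr with hG
  have h0 : (0 : Fin p → ℝ) ∈ Theta p k τ := by
    refine ⟨by simp [l0norm], ?_⟩
    simp
    positivity
  have hGne : G.Nonempty :=
    Finset.Nonempty.image ⟨_, round_mem_sparseGrid p k h τ hh0 hτ.le 0 h0⟩ gr
  have hcard : Fintype.card {i : Fin n // (i : ℕ) < 4 * M} = 4 * M := by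
    exact Fintype.card_fin_lt_of_le (by omega)
  have hcard' : Fintype.card {i : Fin n // ¬ (i : ℕ) < 4 * M} = n - 4 * M := by
    rw [Fintype.card_subtype_compl, hcard, Fintype.card_fin]
  have hcard'' : (Fintype.card {i : Fin n // ¬ (i : ℕ) < 4 * M} : ℝ) - 2 = n - 4 * M - 2 := by
    rw [hcard', Nat.cast_sub (by omega)]
    push_cast
    ring
  obtain ⟨est, hest, hrisk⟩ := exists_twoStage_est n p (fun i : Fin n => (i : ℕ) < 4 * M) lam G hGne
  refine iInf₂_le_of_le est hest (iSup₂_le fun β hβ => ?_)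
  obtain ⟨E, hE1, hE2, hE3⟩ := hrisk σ β
  refine hE3.trans ?_
  set r : (Fin p → ℝ) → ℝ := fun b => (∑ l, (β l - b l) ^ 2) / (n * σ ^ 2) with hr
  have hrV : ∀ b, (∑ l, (β l - b l) ^ 2) / n + σ ^ 2 = σ ^ 2 * (1 + r b) := fun b => by
    simp only [hr]
    field_simp
    ring
  have hr0 : ∀ b, 0 ≤ r b := fun b => by positivity
  set F : ℝ := n / (n - 4 * M - 2) with hFdef
  have hF0 : 0 < F := by positivity
  set good : ℝ := F * (k * V * (2 * (1 + ε) * Λ + (1 + 1 / ε) + 2 / Λ)) with hgood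
  have hgood0 : 0 ≤ good := by positivity
  set K : ℝ := F * (p * (σ ^ 2 * (4 * (1 + 4 * ε) * Λ + 2))) with hK
  have hK0 : 0 ≤ K := by positivity
  have hnear : ∀ b, r b ≤ 4 * ε → ∫⁻ B, ENNReal.ofReal
      (∑ j, (thresholdEst lam b (fun i => rowData σ β (B i)) j - β j) ^ 2)
        ∂(Measure.pi fun _ : {i : Fin n // ¬ (i : ℕ) < 4 * M} => rowLaw n p) ≤
      ENNReal.ofReal good := by
    intro b hb
    refine (thresholdEst_loss_le_sparse n p k hn (by omega) lam σ hlam0.le β b hβ.1 ε hε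
      (lam / V) (by positivity) V ?_).trans (ENNReal.ofReal_le_ofReal (le_of_eq ?_))
    · rw [hrV, hV]
      gcongr
    · have he : V * (lam / V) ^ 2 / 2 - lam / V * lam = -Λ := by
        have : V * (lam / V) ^ 2 / 2 - lam / V * lam = - (lam ^ 2 / (2 * V)) := by
          field_simp
          ring
        rw [this, hlam2]
        field_simp
      rw [he, hexp, hcard'', ← hFdef, div_pow, hlam2, hgood]
      field_simp
      ring
  have hfar : ∀ b, ∫⁻ B, ENNReal.ofReal
      (∑ j, (thresholdEst lam b (fun i => rowData σ β (B i)) j - β j) ^ 2)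
        ∂(Measure.pi fun _ : {i : Fin n // ¬ (i : ℕ) < 4 * M} => rowLaw n p) ≤
      ENNReal.ofReal (K * (1 + r b)) := by
    intro b
    refine (thresholdEst_loss_le_general n p hn (by omega) lam σ hlam0.le β b
      (σ ^ 2 * (1 + r b)) (hrV b).le).trans (ENNReal.ofReal_le_ofReal ?_)
    rw [hcard'', hlam2, hK, mul_assoc F, mul_assoc (p : ℝ)]
    refine mul_le_mul_of_nonneg_left (mul_le_mul_of_nonneg_left ?_ hp'.le) hF0.le
    have h2 : 0 ≤ r b * (4 * Λ * V) := mul_nonneg (hr0 b) (by positivity)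
    rw [hV] at h2 ⊢
    nlinarith
  have hb₀ : (fun j => h * (round (β j / h) : ℝ)) ∈ G :=
    Finset.mem_image_of_mem gr (round_mem_sparseGrid p k h τ hh0 hτ.le β hβ)
  have hrb₀ : r (fun j => h * (round (β j / h) : ℝ)) ≤ ε / 4 := by
    simp only [hr]
    rw [div_le_iff₀ (by positivity)]
    refine (sum_sub_round_sq_le p k h hh0 β hβ.1).trans (le_of_eq ?_)
    rw [hh2]
    field_simp
  have hterm : ∀ b ∈ G, (Measure.pi fun _ : {i : Fin n // (i : ℕ) < 4 * M} => rowLaw n p) (E b) *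
      ∫⁻ B, ENNReal.ofReal (∑ j, (thresholdEst lam b (fun i => rowData σ β (B i)) j - β j) ^ 2)
        ∂(Measure.pi fun _ : {i : Fin n // ¬ (i : ℕ) < 4 * M} => rowLaw n p) ≤
      (Measure.pi fun _ : {i : Fin n // (i : ℕ) < 4 * M} => rowLaw n p) (E b) *
        ENNReal.ofReal good +
      ENNReal.ofReal (if 4 * ε < r b then K * ((1 + r b) * ((1 + ε / 8 * r b)⁻¹) ^ M) else 0) := by
    intro b hb
    split_ifs with hbr
    · refine le_add_of_le_right ?_
      refine (mul_le_mul' (measure_far_selection_le n p M hn hcard σ ε hσ hε hε1 β b _ hrb₀ hbr.le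
        (E b) fun A hAE => hE2 b hb A hAE _ hb₀) (hfar b)).trans_eq ?_
      rw [← ENNReal.ofReal_mul (by have := hr0 b; positivity)]
      congr 1
      ring
    · rw [ENNReal.ofReal_zero, add_zero]
      gcongr
      exact hnear b (not_lt.1 hbr)
  refine (Finset.sum_le_sum hterm).trans ?_
  have hnn : ∀ b, 0 ≤ if 4 * ε < r b then K * ((1 + r b) * ((1 + ε / 8 * r b)⁻¹) ^ M) else 0 := by
    intro b
    have := hr0 b
    split_ifs <;> positivity
  rw [Finset.sum_add_distrib, ← Finset.sum_mul,
    ← ENNReal.ofReal_sum_of_nonneg fun b _ => hnn b]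
  refine (add_le_add (mul_le_mul_left hE1 _) le_rfl).trans ?_
  rw [one_mul, ← ENNReal.ofReal_add hgood0 (Finset.sum_nonneg fun b _ => hnn b)]
  refine ENNReal.ofReal_le_ofReal (add_le_add le_rfl ?_)
  rw [← Finset.sum_filter, ← Finset.mul_sum, hG, Finset.filter_image,
    Finset.sum_image fun u _ v _ huv => hgrinj huv]
  refine mul_le_mul_of_nonneg_left ?_ hK0
  exact sum_far_pilot_le hA p k M hk hp hM ε hε hε1 S (fun j => β j / h) (fun u => r (gr u))
    fun u => by
      have h1 : ∀ l, (β l - h * (u l : ℝ)) ^ 2 = h ^ 2 * ((u l : ℝ) - β l / h) ^ 2 := fun l => by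
        field_simp
        ring
      simp only [hr, hgr, h1]
      rw [← Finset.mul_sum, hh2]
      generalize ∑ l, ((u l : ℝ) - β l / h) ^ 2 = D
      field_simp

lemma eventually_one_le_log (k p : ℕ → ℕ) (hk : ∀ n, 0 < k n) (hkp : ∀ n, k n ≤ p n)
    (hkp0 : Tendsto (fun n => (k n : ℝ) / p n) atTop (nhds 0)) :
    ∀ᶠ n in atTop, 1 ≤ Real.log (p n) := by
  filter_upwards [(tendsto_log_div_atTop k p hk hkp hkp0).eventually_ge_atTop 1] with n hn
  refine hn.trans ?_
  have h1 : (1 : ℝ) ≤ k n := by exact_mod_cast hk n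
  have h2 : (0 : ℝ) < p n := by exact_mod_cast (hk n).trans_le (hkp n)
  exact Real.log_le_log (by positivity) (div_le_self h2.le h1)

lemma eventually_mul_le_of_mul_log (k p : ℕ → ℕ) (hk : ∀ n, 0 < k n) (hkp : ∀ n, k n ≤ p n)
    (hkp0 : Tendsto (fun n => (k n : ℝ) / p n) atTop (nhds 0))
    (hklogp : Tendsto (fun n => (k n : ℝ) * Real.log (p n) / n) atTop (nhds 0))
    {δ : ℝ} (hδ : 0 < δ) :
    ∀ᶠ n : ℕ in atTop, (k n : ℝ) ≤ k n * Real.log (p n) ∧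
      (k n : ℝ) * Real.log (p n) ≤ δ * n := by
  filter_upwards [eventually_one_le_log k p hk hkp hkp0, hklogp.eventually_lt_const hδ,
    eventually_gt_atTop 0] with n h1 h2 h3
  have h3' : (0 : ℝ) < n := by exact_mod_cast h3
  exact ⟨le_mul_of_one_le_right (Nat.cast_nonneg _) h1, ((div_lt_iff₀ h3').1 h2).le⟩

lemma tendsto_far_term (k p : ℕ → ℕ) (hk : ∀ n, 0 < k n) (hkp : ∀ n, k n ≤ p n)
    (hkp0 : Tendsto (fun n => (k n : ℝ) / p n) atTop (nhds 0))
    (hklogp : Tendsto (fun n => (k n : ℝ) * Real.log (p n) / n) atTop (nhds 0))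
    (ε Q C : ℝ) (hε : 0 < ε) (hQ : 1 < Q) (hC : 0 ≤ C) :
    Tendsto (fun n : ℕ => (p n : ℝ) * (Q⁻¹ ^ (⌊ε * n⌋₊ - 1 - k n) *
      ((p n : ℝ) ^ k n * Real.exp (C * k n)))) atTop (nhds 0) := by
  have hL : 0 < Real.log Q := Real.log_pos hQ
  have hQ0 : 0 < Q := one_pos.trans hQ
  set L := Real.log Q with hLdef
  set δ := ε * L / (2 * (2 + C + L)) with hδ
  have hδ0 : 0 < δ := by positivity
  have hlim : Tendsto (fun n : ℕ => Real.exp (2 * L + -(ε * L / 2) * n)) atTop (nhds 0) := by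
    refine Real.tendsto_exp_atBot.comp (tendsto_atBot_add_const_left _ _ ?_)
    exact tendsto_natCast_atTop_atTop.const_mul_atTop_of_neg (by
      have : 0 < ε * L / 2 := by positivity
      linarith)
  refine squeeze_zero' (Eventually.of_forall fun n => by positivity) ?_ hlim
  filter_upwards [eventually_mul_le_of_mul_log k p hk hkp hkp0 hklogp hδ0] with n ⟨h1, h2⟩
  have hp : (0 : ℝ) < p n := by exact_mod_cast (hk n).trans_le (hkp n)
  have hk1 : (1 : ℝ) ≤ k n := by exact_mod_cast hk n
  have hp1 : (1 : ℝ) ≤ p n := by exact_mod_cast (hk n).trans_le (hkp n)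
  have hlp := Real.log_nonneg hp1
  have hq : Q⁻¹ ^ (⌊ε * n⌋₊ - 1 - k n) = Real.exp (-((⌊ε * n⌋₊ - 1 - k n : ℕ) * L)) := by
    rw [Real.exp_neg, Real.exp_nat_mul, hLdef, Real.exp_log hQ0, inv_pow]
  have hpk : (p n : ℝ) ^ k n = Real.exp (k n * Real.log (p n)) := by
    rw [Real.exp_nat_mul, Real.exp_log hp]
  rw [hq, hpk]
  nth_rewrite 1 [← Real.exp_log hp]
  rw [← Real.exp_add, ← Real.exp_add, ← Real.exp_add]
  refine Real.exp_le_exp.2 ?_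
  have h3 : ε * n - 2 - k n ≤ (⌊ε * n⌋₊ - 1 - k n : ℕ) := by
    have h4 := Nat.lt_floor_add_one (ε * n)
    have h5 : ⌊ε * n⌋₊ ≤ (⌊ε * n⌋₊ - 1 - k n) + 1 + k n := by omega
    have h6 : (⌊ε * n⌋₊ : ℝ) ≤ (⌊ε * n⌋₊ - 1 - k n : ℕ) + 1 + k n := by exact_mod_cast h5
    linarith
  have h7 : (ε * n - 2 - k n) * L ≤ (⌊ε * n⌋₊ - 1 - k n : ℕ) * L := by gcongr
  have h8 : Real.log (p n) ≤ k n * Real.log (p n) := le_mul_of_one_le_left hlp hk1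
  have h9 : (2 + C + L) * (k n * Real.log (p n)) ≤ (2 + C + L) * (δ * n) := by gcongr
  have h10 : (2 + C + L) * (δ * n) = ε * L / 2 * n := by
    rw [hδ]
    field_simp
  have h11 : C * k n ≤ C * (k n * Real.log (p n)) := by gcongr
  have h12 : L * k n ≤ L * (k n * Real.log (p n)) := by gcongr
  nlinarith

lemma tendsto_sample_split_ratio (ε : ℝ) (hε : 0 ≤ ε) (hε1 : ε < 1 / 4) :
    Tendsto (fun n : ℕ => (n : ℝ) / (n - 4 * ⌊ε * n⌋₊ - 2)) atTop (nhds (1 / (1 - 4 * ε))) := by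
  have h1 : Tendsto (fun n : ℕ => (⌊ε * n⌋₊ : ℝ) / n) atTop (nhds ε) :=
    (tendsto_nat_floor_mul_div_atTop hε).comp tendsto_natCast_atTop_atTop
  have h2 : Tendsto (fun n : ℕ => (2 : ℝ) / n) atTop (nhds 0) :=
    tendsto_const_div_atTop_nhds_zero_nat 2
  have h3 : Tendsto (fun n : ℕ => 1 / (1 - 4 * ((⌊ε * n⌋₊ : ℝ) / n) - 2 / n)) atTop
      (nhds (1 / (1 - 4 * ε - 0))) :=
    tendsto_const_nhds.div ((tendsto_const_nhds.sub (h1.const_mul 4)).sub h2) (by linarith)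
  rw [sub_zero] at h3
  refine h3.congr' ?_
  filter_upwards [eventually_gt_atTop 0] with n hn
  have hn' : (n : ℝ) ≠ 0 := by exact_mod_cast hn.ne'
  rw [← mul_div_mul_left 1 _ hn']
  congr 1
  · ring
  · field_simp

lemma exists_small_slack {c : ℝ} (hc : 1 < c) : ∃ ε : ℝ, 0 < ε ∧ ε < 1 / 4 ∧
    1 / (1 - 4 * ε) * ((1 + 4 * ε) * (1 + ε)) < c := by
  have h1 : ContinuousAt (fun ε : ℝ => 1 / (1 - 4 * ε) * ((1 + 4 * ε) * (1 + ε))) 0 := by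
    have : (1 : ℝ) - 4 * 0 ≠ 0 := by norm_num
    fun_prop (disch := assumption)
  have h2 : ∀ᶠ ε in nhds (0 : ℝ), 1 / (1 - 4 * ε) * ((1 + 4 * ε) * (1 + ε)) < c :=
    h1.eventually_lt_const (by norm_num; exact hc)
  have h3 := (h2.filter_mono nhdsWithin_le_nhds).and
    (Ioo_mem_nhdsGT (show (0 : ℝ) < 1 / 4 by norm_num))
  obtain ⟨ε, h4, h5⟩ := h3.exists
  exact ⟨ε, h5.1, h5.2, h4⟩

lemma eventually_minimaxRisk_ratio_lt (k p : ℕ → ℕ) (τ σ : ℕ → ℝ)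
    (hk : ∀ n, 0 < k n) (hkp : ∀ n, k n ≤ p n) (hτ : ∀ n, 0 < τ n) (hσ : ∀ n, 0 < σ n)
    (hkp0 : Tendsto (fun n => (k n : ℝ) / p n) atTop (nhds 0))
    (hklogp : Tendsto (fun n => (k n : ℝ) * Real.log (p n) / n) atTop (nhds 0))
    {c : ℝ} (hc : 1 < c) :
    ∀ᶠ n in atTop, minimaxRisk n (p n) (k n) (τ n) (σ n) ≠ ⊤ ∧
      (minimaxRisk n (p n) (k n) (τ n) (σ n)).toReal /
        (2 * σ n ^ 2 * k n * Real.log ((p n : ℝ) / k n)) < c := by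
  obtain ⟨ε, hε, hε1, hεc⟩ := exists_small_slack hc
  obtain ⟨A₀, hA0, hA⟩ := exists_sum_inv_one_add_sq_le
  have hΛ := tendsto_log_div_atTop k p hk hkp hkp0
  have hF := tendsto_sample_split_ratio ε hε.le hε1
  have hfar := tendsto_far_term k p hk hkp hkp0 hklogp ε (1 + ε ^ 2 / 2) (8 * A₀ / ε ^ 2) hε
    (by have : 0 < ε ^ 2 := by positivity
        linarith) (by positivity)
  have hlow : Tendsto (fun n => ((1 + 1 / ε) + 2 / Real.log ((p n : ℝ) / k n)) /
      (2 * Real.log ((p n : ℝ) / k n))) atTop (nhds 0) :=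
    (tendsto_const_nhds.add (tendsto_const_nhds.div_atTop hΛ)).div_atTop
      (hΛ.const_mul_atTop two_pos)
  have hlim := (hF.mul ((hlow.const_add (1 + ε)).const_mul (1 + 4 * ε))).add
    ((hF.mul hfar).const_mul (40 / ε))
  rw [add_zero, mul_zero, mul_zero, add_zero] at hlim
  filter_upwards [hlim.eventually_lt_const hεc, hΛ.eventually_ge_atTop 1,
    eventually_mul_le_of_mul_log k p hk hkp hkp0 hklogp (half_pos hε),
    hkp0.eventually_lt_const one_pos,
    tendsto_natCast_atTop_atTop.eventually_gt_atTop (4 / ε),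
    tendsto_natCast_atTop_atTop.eventually_gt_atTop (2 / (1 - 4 * ε))] with n h1 h2 h3 h4 h5 h6
  have hkn := hk n
  have hk' : (0 : ℝ) < k n := by exact_mod_cast hkn
  have hk1 : (1 : ℝ) ≤ k n := by exact_mod_cast hkn
  have hp' : (0 : ℝ) < p n := by exact_mod_cast hkn.trans_le (hkp n)
  have hσn := hσ n
  have hlt : k n < p n := by
    rw [div_lt_one hp'] at h4
    exact_mod_cast h4
  have hfl := Nat.floor_le (show 0 ≤ ε * (n : ℝ) by positivity)
  have hfl' := Nat.lt_floor_add_one (ε * (n : ℝ))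
  rw [div_lt_iff₀ hε] at h5
  rw [div_lt_iff₀ (by linarith)] at h6
  have hM : k n + 1 ≤ ⌊ε * (n : ℝ)⌋₊ := by
    refine Nat.le_floor ?_
    push_cast
    linarith [h3.1, h3.2]
  have hMn : 4 * ⌊ε * (n : ℝ)⌋₊ + 2 < n := by
    have : (4 * ⌊ε * (n : ℝ)⌋₊ + 2 : ℝ) < n := by linarith
    exact_mod_cast this
  have hrisk := minimaxRisk_le_explicit hA n (p n) (k n) ⌊ε * (n : ℝ)⌋₊ hkn hlt hM hMn (τ n) (σ n) ε
    (hτ n) hσn hε hε1.le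
  refine ⟨ne_top_of_le_ne_top ENNReal.ofReal_ne_top hrisk, ?_⟩
  have hF0 : (0 : ℝ) < n / (n - 4 * ⌊ε * (n : ℝ)⌋₊ - 2) := by
    have : (4 * ⌊ε * (n : ℝ)⌋₊ + 2 : ℝ) < n := by exact_mod_cast hMn
    exact div_pos (by exact_mod_cast (by omega : 0 < n)) (by linarith)
  set Λ := Real.log ((p n : ℝ) / k n) with hΛdef
  have hΛ0 : 0 < Λ := by linarith
  have hreal := ENNReal.toReal_le_of_le_ofReal (by positivity) hrisk
  refine lt_of_le_of_lt ?_ h1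
  rw [div_le_iff₀ (by positivity)]
  refine hreal.trans ?_
  rw [add_mul]
  set F : ℝ := n / (n - 4 * ⌊ε * (n : ℝ)⌋₊ - 2) with hFdef
  refine add_le_add (le_of_eq ?_) ?_
  · field_simp
    ring
  · have he : 8 * A₀ / ε ^ 2 * k n = 8 * A₀ * k n / ε ^ 2 := by ring
    rw [he]
    set W := (1 + ε ^ 2 / 2)⁻¹ ^ (⌊ε * (n : ℝ)⌋₊ - 1 - k n) *
      ((p n : ℝ) ^ k n * Real.exp (8 * A₀ * k n / ε ^ 2)) with hW
    have hW0 : 0 ≤ W := by positivity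
    have h7 : 4 * (1 + 4 * ε) * Λ + 2 ≤ 10 * (k n * Λ) := by nlinarith
    calc F * (p n * (σ n ^ 2 * (4 * (1 + 4 * ε) * Λ + 2))) * (8 / ε *
          (1 + ε ^ 2 / 2)⁻¹ ^ (⌊ε * (n : ℝ)⌋₊ - 1 - k n) *
          ((p n : ℝ) ^ k n * Real.exp (8 * A₀ * k n / ε ^ 2)))
        = F * (p n * (σ n ^ 2 * (4 * (1 + 4 * ε) * Λ + 2))) * (8 / ε * W) := by rw [hW]; ring
      _ ≤ F * (p n * (σ n ^ 2 * (10 * (k n * Λ)))) * (8 / ε * W) := by gcongr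
      _ = 40 / ε * (F * (p n * W)) * (2 * σ n ^ 2 * k n * Λ) := by
        field_simp
        ring

/-- **Theorem 2, Regime III (high SNR).** If `k/p → 0`, `(k log p)/n → 0` and
`μ = τ/σ = ω(√(log(p/k)))`, then `R(Θ(k,τ),σ) = 2 σ² k log(p/k) (1 + o(1))`. -/
theorem regimeIII_first_order_minimax
    (k p : ℕ → ℕ) (τ σ : ℕ → ℝ)
    (hk : ∀ n, 0 < k n) (hkp : ∀ n, k n ≤ p n)
    (hτ : ∀ n, 0 < τ n) (hσ : ∀ n, 0 < σ n)
    (hkp0 : Tendsto (fun n => (k n : ℝ) / p n) atTop (nhds 0))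
    (hklogp : Tendsto (fun n => (k n : ℝ) * Real.log (p n) / n) atTop (nhds 0))
    (hμ : Tendsto (fun n => (τ n / σ n) / Real.sqrt (Real.log ((p n : ℝ) / k n)))
      atTop atTop) :
    Tendsto (fun n => (minimaxRisk n (p n) (k n) (τ n) (σ n)).toReal /
        (2 * σ n ^ 2 * k n * Real.log ((p n : ℝ) / k n)))
      atTop (nhds 1) := by
  have hfin : ∀ᶠ n in atTop, minimaxRisk n (p n) (k n) (τ n) (σ n) ≠ ⊤ :=
    (eventually_minimaxRisk_ratio_lt k p τ σ hk hkp hτ hσ hkp0 hklogp one_lt_two).mono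
      fun n h => h.1
  exact tendsto_order.2
    ⟨fun c hc => eventually_lt_minimaxRisk_ratio k p τ σ hk hkp hσ hkp0 hklogp hμ hfin hc,
      fun c hc => (eventually_minimaxRisk_ratio_lt k p τ σ hk hkp hτ hσ hkp0 hklogp hc).mono
        fun n h => h.2⟩
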